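/- Let W be a simply-laced Weyl group, π a dominant integral weight with Stab_W(π) = W_P, and let v ≤ w be π-minuscule elements such that w v^{−1} is π′-minuscule for some dominant integral weight π′. Then, as rational functions, the sum over all integers r ≥ 0 and all directed paths v ≤ x_r →β_r x_{r−1} → ⋯ → x_1 →β_1 x_0 = w in W^P of the product (1/β_1)·(1/(β_1+β_2))·…·(1/(β_1+⋯+β_r)) equals ∏_{β ∈ S(w/v)} (1 + 1/β). -/

import Mathlib

open scoped Classical BigOperators

/-- A bundled setting for a finite crystallographic root system together with its
Weyl group, its action on the rational span of the weight lattice, reflections,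
and the data of coefficients of roots in the basis of simple roots. -/
structure WeylSetting where
  /-- index set of the Dynkin diagram (simple roots) -/
  I : Type
  [fintypeI : Fintype I]
  [decEqI : DecidableEq I]
  /-- rational span of the weight lattice -/
  V : Type
  [acg : AddCommGroup V]
  [mod : Module ℚ V]
  /-- the Weyl group -/
  W : Type
  [grp : Group W]
  /-- the action of the Weyl group on weights -/
  act : W →* (V ≃ₗ[ℚ] V)
  /-- the simple roots -/
  simple : I → V
  /-- the (finite) set of roots -/
  roots : Finset V
  /-- `coroot β μ` is the pairing `⟨μ, β∨⟩` -/
  coroot : V → (V →ₗ[ℚ] ℚ)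
  /-- the reflection `s_β ∈ W` associated to a root `β` -/
  srefl : V → W
  /-- coefficients of a positive root in the basis of simple roots -/
  posCoeff : V → I → ℕ
  simple_mem : ∀ i, simple i ∈ roots
  simple_indep : LinearIndependent ℚ simple
  roots_neg : ∀ β ∈ roots, -β ∈ roots
  root_pos_or_neg : ∀ β ∈ roots,
    (∃ c : I → ℚ, (∀ i, 0 ≤ c i) ∧ β = ∑ i, c i • simple i) ∨
    (∃ c : I → ℚ, (∀ i, 0 ≤ c i) ∧ -β = ∑ i, c i • simple i)
  coroot_self : ∀ β ∈ roots, coroot β β = 2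
  crystallographic : ∀ β ∈ roots, ∀ γ ∈ roots, ∃ n : ℤ, coroot β γ = n
  posCoeff_spec : ∀ β ∈ roots,
    (∃ c : I → ℚ, (∀ i, 0 ≤ c i) ∧ β = ∑ i, c i • simple i) →
    β = ∑ i, (posCoeff β i : ℚ) • simple i
  srefl_apply : ∀ β ∈ roots, ∀ v : V, act (srefl β) v = v - coroot β v • β
  act_faithful : ∀ g : W, (∀ v : V, act g v = v) → g = 1
  roots_invariant : ∀ g : W, ∀ β ∈ roots, act g β ∈ roots
  coroot_equivariant : ∀ g : W, ∀ β ∈ roots, ∀ v : V,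
    coroot (act g β) (act g v) = coroot β v
  generated : ∀ g : W, ∃ l : List I, g = (l.map fun i => srefl (simple i)).prod

namespace WeylSetting

attribute [instance] fintypeI decEqI acg mod grp

variable (D : WeylSetting)

/-- the simple reflection attached to a node of the Dynkin diagram -/
def s (i : D.I) : D.W := D.srefl (D.simple i)

/-- the product `s_{i_1} ⋯ s_{i_r}` of the simple reflections listed in `l` -/
def wordProd (l : List D.I) : D.W := (l.map D.s).prod

/-- `β` is a positive root: a root which is a nonnegative combination of simple roots -/
def IsPosRoot (β : D.V) : Prop :=
  β ∈ D.roots ∧ ∃ c : D.I → ℚ, (∀ i, 0 ≤ c i) ∧ β = ∑ i, c i • D.simple i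

/-- the length of a Weyl group element -/
noncomputable def length (g : D.W) : ℕ :=
  sInf {n | ∃ l : List D.I, l.length = n ∧ D.wordProd l = g}

/-- `l` is a reduced word for `g` -/
def IsReduced (l : List D.I) (g : D.W) : Prop :=
  D.wordProd l = g ∧ l.length = D.length g

/-- the number of reduced words of `g` -/
noncomputable def RedCard (g : D.W) : ℕ := Nat.card {l : List D.I // D.IsReduced l g}

/-- the (strong) Bruhat order on the Weyl group -/
def bruhatLE : D.W → D.W → Prop :=
  Relation.ReflTransGen
    (fun a b => (∃ β, D.IsPosRoot β ∧ b = D.srefl β * a) ∧ D.length a < D.length b)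

/-- strict (strong) Bruhat order -/
def bruhatLT (a b : D.W) : Prop := D.bruhatLE a b ∧ a ≠ b

/-- the left weak Bruhat order: `a ≤_L b` iff `ℓ(b a⁻¹) + ℓ(a) = ℓ(b)` -/
def weakLE (a b : D.W) : Prop := D.length (b * a⁻¹) + D.length a = D.length b

/-- the height of a positive root: the sum of its coefficients in the simple roots -/
noncomputable def ht (β : D.V) : ℕ := ∑ i, D.posCoeff β i

/-- an integral weight: the pairings with all positive coroots are integers -/
def IsIntegral (lam : D.V) : Prop :=
  ∀ β, D.IsPosRoot β → ∃ n : ℤ, D.coroot β lam = n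

/-- a dominant integral weight -/
def IsDominant (lam : D.V) : Prop :=
  D.IsIntegral lam ∧ ∀ i, 0 ≤ D.coroot (D.simple i) lam

/-- a pre-dominant integral weight: `⟨λ, β∨⟩ ≥ -1` for all positive roots `β` -/
def IsPreDominant (lam : D.V) : Prop :=
  D.IsIntegral lam ∧ ∀ β, D.IsPosRoot β → -1 ≤ D.coroot β lam

/-- the diagram `D(λ) = {β ∈ R⁺ : ⟨λ, β∨⟩ = -1}` of a pre-dominant weight -/
noncomputable def diagram (lam : D.V) : Finset D.V :=
  D.roots.filter fun β => D.IsPosRoot β ∧ D.coroot β lam = -1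

/-- `IsWeightPath λ [β₁, …, β_r]` says that
`λ = λ₀ →β₁ λ₁ →β₂ ⋯ →β_r λ_r` is a `λ`-path, i.e. each `β_j` is a positive
root, `⟨λ_{j-1}, β_j∨⟩ = -1` and `λ_j = s_{β_j}(λ_{j-1})`. -/
def IsWeightPath : D.V → List D.V → Prop
  | _, [] => True
  | lam, β :: rest =>
      D.IsPosRoot β ∧ D.coroot β lam = -1 ∧
        IsWeightPath (D.act (D.srefl β) lam) rest

/-- the term `1/β₁ ⋅ 1/(β₁+β₂) ⋅ … ⋅ 1/(β₁+⋯+β_r)` attached to a path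
`(β₁, …, β_r)`, computed in a field `F` via a linear embedding `emb`. -/
noncomputable def pathTerm {F : Type} [Field F] [Algebra ℚ F]
    (emb : D.V →ₗ[ℚ] F) (l : List D.V) : F :=
  ∏ j ∈ Finset.range l.length, (emb ((l.take (j + 1)).sum))⁻¹

/-- `w` is a π-minuscule element (in the sense of Peterson). -/
def IsMinuscule (pi : D.V) (w : D.W) : Prop :=
  ∃ l : List D.I, D.IsReduced l w ∧
    ∀ k : Fin l.length,
      D.coroot (D.simple (l.get k)) (D.act (D.wordProd (l.drop (k.val + 1))) pi) = 1

/-- the stabilizer `W_π = Stab_W(π)` of a weight -/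
def stab (pi : D.V) : Subgroup D.W where
  carrier := {g | D.act g pi = pi}
  one_mem' := by simp
  mul_mem' := by
    intro a b ha hb
    simp only [Set.mem_setOf_eq] at *
    calc D.act (a * b) pi = D.act a (D.act b pi) := by rw [map_mul]; rfl
    _ = pi := by rw [hb, ha]
  inv_mem' := by
    intro a ha
    simp only [Set.mem_setOf_eq] at *
    calc D.act a⁻¹ pi = D.act a⁻¹ (D.act a pi) := by rw [ha]
    _ = D.act (a⁻¹ * a) pi := by rw [map_mul]; rfl
    _ = pi := by simp

/-- `u` is the minimal-length representative of its coset `uH` -/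
def IsMinRep (H : Subgroup D.W) (u : D.W) : Prop :=
  ∀ g : D.W, u⁻¹ * g ∈ H → D.length u ≤ D.length g

/-- `a` and `b` lie in the same coset of `H`, i.e. `aH = bH` -/
def SameCoset (H : Subgroup D.W) (a b : D.W) : Prop := a⁻¹ * b ∈ H

/-- `u →β w` in `W^P`: `β` is a positive root, `u, w` are minimal-length
representatives, `s_β w H = u H`, and `u < w` in Bruhat order -/
def Arrow (H : Subgroup D.W) (u w : D.W) (β : D.V) : Prop :=
  D.IsPosRoot β ∧ D.IsMinRep H u ∧ D.IsMinRep H w ∧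
    D.SameCoset H (D.srefl β * w) u ∧ D.bruhatLT u w

/-- `ArrowPath H w [β₁, …, β_r]` encodes a directed path
`x_r →β_r ⋯ → x_1 →β₁ x_0 = w` in the Bruhat graph on `W^P`. -/
def ArrowPath (H : Subgroup D.W) : D.W → List D.V → Prop
  | _, [] => True
  | w, β :: rest => ∃ u, D.Arrow H u w β ∧ ArrowPath H u rest

/-- directed paths as above whose vertices all lie above `v` in Bruhat order -/
def ArrowPathGE (H : Subgroup D.W) (v : D.W) : D.W → List D.V → Prop
  | _, [] => True
  | w, β :: rest => ∃ u, D.Arrow H u w β ∧ D.bruhatLE v u ∧ ArrowPathGE H v u rest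

/-- directed paths from `u` to `w`:
`u = x_r →β_r ⋯ → x_1 →β₁ x_0 = w` encoded by the list `[β₁, …, β_r]`. -/
def ArrowPathFromTo (H : Subgroup D.W) (u : D.W) : D.W → List D.V → Prop
  | w, [] => u = w
  | w, β :: rest => ∃ x, D.Arrow H x w β ∧ ArrowPathFromTo H u x rest

/-- `S(w) = {β ∈ R⁺ : s_β w < w}` -/
noncomputable def Sset (w : D.W) : Finset D.V :=
  D.roots.filter fun β => D.IsPosRoot β ∧ D.bruhatLT (D.srefl β * w) w

/-- `S(w/v) = {β ∈ R⁺ : v ≤ s_β w < w}` -/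
noncomputable def SsetSkew (v w : D.W) : Finset D.V :=
  D.roots.filter fun β =>
    D.IsPosRoot β ∧ D.bruhatLE v (D.srefl β * w) ∧ D.bruhatLT (D.srefl β * w) w

/-- an oriented edge `x → y` in the Bruhat graph of `G/P`: `x, y` are minimal
representatives, `xH < yH`, and `yH = x s_γ H` for some positive root `γ` -/
def GEdge (H : Subgroup D.W) (x y : D.W) : Prop :=
  D.IsMinRep H x ∧ D.IsMinRep H y ∧ D.bruhatLT x y ∧
    ∃ γ, D.IsPosRoot γ ∧ D.SameCoset H (x * D.srefl γ) y

/-- the (unique) positive root `γ` with `yH = x s_γ H` attached to an edge -/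
noncomputable def edgeRoot (H : Subgroup D.W) (x y : D.W) : D.V :=
  if h : ∃ γ, D.IsPosRoot γ ∧ D.SameCoset H (x * D.srefl γ) y then h.choose else 0

/-- `GChainTo H v t [x₁, …, x_r]` encodes a directed path
`v ≤ x_r → ⋯ → x_1 → x_0 = t` in the Bruhat graph of `G/P` -/
def GChainTo (H : Subgroup D.W) (v : D.W) : D.W → List D.W → Prop
  | _, [] => True
  | t, x :: rest => D.GEdge H x t ∧ D.bruhatLE v x ∧ GChainTo H v x rest

/-- the weighted term
`(m_Λ(x_r,x_{r-1})/W_Λ(x_r)) ⋯ (m_Λ(x_1,x_0)/W_Λ(x_1))` of a path in the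
`Λ`-Bruhat graph, computed in a field `F` via a linear embedding `emb`. -/
noncomputable def chainTerm {F : Type} [Field F] [Algebra ℚ F]
    (emb : D.V →ₗ[ℚ] F) (H : Subgroup D.W) (Lam : D.W → D.V) (w : D.W) :
    D.W → List D.W → F
  | _, [] => 1
  | t, x :: rest =>
      algebraMap ℚ F (D.coroot (D.edgeRoot H x t) (Lam x)) *
        (emb (D.act x (Lam x) - D.act w (Lam x)))⁻¹ *
        chainTerm emb H Lam w x rest

/-- the Bruhat order on cosets: `aH ≤ bH` -/
def cosetLE (H : Subgroup D.W) (a b : D.W) : Prop :=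
  ∃ x y, D.SameCoset H a x ∧ D.SameCoset H b y ∧ D.bruhatLE x y

/-- the (standard) parabolic subgroup generated by simple reflections in `J` -/
def parab (J : Set D.I) : Subgroup D.W := Subgroup.closure (D.s '' J)

/-- `X*(T)_P`: integral weights orthogonal to all coroots of `W_P`,
i.e. to `γ∨` for all positive roots `γ` in the span of the simple roots of `P` -/
def OrthWeightP (J : Set D.I) (lam : D.V) : Prop :=
  D.IsIntegral lam ∧
    ∀ γ, D.IsPosRoot γ → γ ∈ Submodule.span ℚ (D.simple '' J) → D.coroot γ lam = 0

/-- an admissible function `Λ : [v,w]^P → X*(T)_P` -/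
def Admissible (J : Set D.I) (v w : D.W) (Lam : D.W → D.V) : Prop :=
  (∀ x, D.IsMinRep (D.parab J) x → D.bruhatLE v x → D.bruhatLE x w →
      D.OrthWeightP J (Lam x)) ∧
  (∀ x, D.IsMinRep (D.parab J) x → D.bruhatLE v x → D.bruhatLE x w → x ≠ w →
      D.act x (Lam x) ≠ D.act w (Lam x))

/-- the subword of `l` with letters at the positions in `S`, in increasing order -/
def subwordF (l : List D.I) (S : Finset (Fin l.length)) : List D.I :=
  ((List.finRange l.length).filter fun j => j ∈ S).map l.get

/-- `β_j = s_{i_1} ⋯ s_{i_{j-1}}(α_{i_j})` attached to a reduced word `l` -/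
noncomputable def refRoot (l : List D.I) (j : Fin l.length) : D.V :=
  D.act (D.wordProd (l.take j.val)) (D.simple (l.get j))

/-- the Weyl group is simply laced: the Cartan pairing is symmetric -/
def SimplyLaced : Prop :=
  ∀ i j, D.coroot (D.simple i) (D.simple j) = D.coroot (D.simple j) (D.simple i)

/-- generating relation of the heap order of the word `l`:
`p_j < p_k` whenever `j < k` and `s_{i_j}`, `s_{i_k}` do not commute -/
def heapCovers (l : List D.I) (j k : Fin l.length) : Prop :=
  (j : ℕ) < (k : ℕ) ∧ D.s (l.get j) * D.s (l.get k) ≠ D.s (l.get k) * D.s (l.get j)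

/-- the heap order of the word `l`: the minimal partial order generated by
`heapCovers` -/
def heapLE (l : List D.I) : Fin l.length → Fin l.length → Prop :=
  Relation.ReflTransGen (D.heapCovers l)

/-- strict heap order -/
def heapLT (l : List D.I) (j k : Fin l.length) : Prop := D.heapLE l j k ∧ j ≠ k

/-- `F` is an order filter of the heap `H(w)` of the word `l` -/
def IsHeapFilter (l : List D.I) (F : Finset (Fin l.length)) : Prop :=
  ∀ j k, j ∈ F → D.heapLE l j k → k ∈ F

/-- `i` and `j` are joined by an edge of the Dynkin diagram -/
def adjDynkin (i j : D.I) : Prop := i ≠ j ∧ D.s i * D.s j ≠ D.s j * D.s i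

/-- an elementary excitation `A ▷ B` of subsets of the heap of the word `l` -/
def Excite (l : List D.I) (A B : Finset (Fin l.length)) : Prop :=
  ∃ p q, D.heapLT l p q ∧ l.get p = l.get q ∧ q ∈ A ∧ p ∈ B ∧
    A.erase q = B.erase p ∧
    (∀ z, D.heapLT l p z → D.heapLT l z q → l.get z ≠ l.get p) ∧
    ∀ u ∈ A, D.heapLE l p u → D.heapLE l u q → ¬ D.adjDynkin (l.get p) (l.get u)

/-- `A` is an excited diagram of `F` in the heap of the word `l`,
i.e. `A ∈ E_{H(w)}(F)` -/
def InExcited (l : List D.I) (F A : Finset (Fin l.length)) : Prop :=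
  Relation.ReflTransGen (D.Excite l) F A

end WeylSetting

namespace WeylSetting

section helper
variable (D : WeylSetting)

lemma act_mul (g h : D.W) (x : D.V) : D.act (g * h) x = D.act g (D.act h x) := by
  rw [map_mul]; rfl

lemma act_one (x : D.V) : D.act 1 x = x := by
  rw [map_one]; rfl

lemma act_inv_act (g : D.W) (x : D.V) : D.act g⁻¹ (D.act g x) = x := by
  rw [← act_mul, inv_mul_cancel, act_one]

lemma act_act_inv (g : D.W) (x : D.V) : D.act g (D.act g⁻¹ x) = x := by
  rw [← act_mul, mul_inv_cancel, act_one]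

lemma exists_coef : ∃ f : D.V →ₗ[ℚ] (D.I → ℚ), ∀ i, f (D.simple i) = Pi.single i 1 := by
  have h := D.simple_indep
  rw [linearIndependent_iff_injective_fintypeLinearCombination] at h
  obtain ⟨f, hf⟩ := LinearMap.exists_leftInverse_of_injective
    (Fintype.linearCombination ℚ D.simple) (LinearMap.ker_eq_bot.mpr h)
  refine ⟨f, fun i => ?_⟩
  have := congrArg (fun g => g (Pi.single i (1 : ℚ))) hf
  simpa using this

/-- coordinates along the simple roots (extended arbitrarily to all of `V`) -/
noncomputable def coef : D.V →ₗ[ℚ] (D.I → ℚ) := D.exists_coef.choose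

lemma coef_simple (i j : D.I) : D.coef (D.simple i) j = if j = i then 1 else 0 := by
  have := D.exists_coef.choose_spec i
  unfold coef
  rw [this, Pi.single_apply]

lemma coef_comb (c : D.I → ℚ) : D.coef (∑ i, c i • D.simple i) = c := by
  funext j
  rw [map_sum, Finset.sum_apply]
  simp [coef_simple]

lemma root_expand {β : D.V} (h : β ∈ D.roots) : ∑ i, D.coef β i • D.simple i = β := by
  rcases D.root_pos_or_neg β h with ⟨c, -, hc⟩ | ⟨c, -, hc⟩
  · rw [hc, coef_comb]
  · have : β = ∑ i, (-c i) • D.simple i := by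
      simp only [neg_smul, Finset.sum_neg_distrib, ← hc, neg_neg]
    rw [this, coef_comb D (fun i => - c i)]

lemma isPosRoot_iff {β : D.V} : D.IsPosRoot β ↔ β ∈ D.roots ∧ ∀ i, 0 ≤ D.coef β i := by
  constructor
  · rintro ⟨h, c, hc, rfl⟩
    refine ⟨h, ?_⟩
    rw [coef_comb]; exact hc
  · rintro ⟨h, hc⟩
    exact ⟨h, D.coef β, hc, (D.root_expand h).symm⟩

lemma pos_or_neg {β : D.V} (h : β ∈ D.roots) :
    (∀ i, 0 ≤ D.coef β i) ∨ (∀ i, D.coef β i ≤ 0) := by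
  rcases D.root_pos_or_neg β h with ⟨c, h0, hc⟩ | ⟨c, h0, hc⟩
  · left; rw [hc, coef_comb]; exact h0
  · right
    intro i
    have : D.coef (-β) i = c i := by rw [hc, coef_comb]
    rw [map_neg, Pi.neg_apply] at this
    have := h0 i
    linarith

lemma root_ne_zero {β : D.V} (h : β ∈ D.roots) : β ≠ 0 := by
  rintro rfl
  have := D.coroot_self 0 h
  simp at this

/-- invariant symmetric form -/
noncomputable def bf (x y : D.V) : ℚ := ∑ γ ∈ D.roots, D.coroot γ x * D.coroot γ y

lemma bf_act (g : D.W) (x y : D.V) : D.bf (D.act g x) (D.act g y) = D.bf x y := by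
  unfold bf
  symm
  refine Finset.sum_bij' (fun γ _ => D.act g γ) (fun γ _ => D.act g⁻¹ γ) ?_ ?_ ?_ ?_ ?_
  · intro γ h; exact D.roots_invariant _ _ h
  · intro γ h; exact D.roots_invariant _ _ h
  · intro γ h; exact D.act_inv_act _ _
  · intro γ h; exact D.act_act_inv _ _
  · intro γ h
    rw [D.coroot_equivariant _ _ h, D.coroot_equivariant _ _ h]

lemma bf_comm (x y : D.V) : D.bf x y = D.bf y x := by
  unfold bf; exact Finset.sum_congr rfl fun _ _ => mul_comm _ _

lemma bf_self_nonneg (x : D.V) : 0 ≤ D.bf x x :=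
  Finset.sum_nonneg fun _ _ => mul_self_nonneg _

lemma bf_self_pos {β : D.V} (h : β ∈ D.roots) : 0 < D.bf β β := by
  refine Finset.sum_pos' (fun _ _ => mul_self_nonneg _) ⟨β, h, ?_⟩
  rw [D.coroot_self β h]; norm_num

lemma bf_sub_left (x y z : D.V) : D.bf (x - y) z = D.bf x z - D.bf y z := by
  unfold bf; rw [← Finset.sum_sub_distrib]
  exact Finset.sum_congr rfl fun _ _ => by rw [map_sub]; ring

lemma bf_add_left (x y z : D.V) : D.bf (x + y) z = D.bf x z + D.bf y z := by
  unfold bf; rw [← Finset.sum_add_distrib]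
  exact Finset.sum_congr rfl fun _ _ => by rw [map_add]; ring

lemma bf_smul_left (c : ℚ) (x z : D.V) : D.bf (c • x) z = c * D.bf x z := by
  unfold bf; rw [Finset.mul_sum]
  exact Finset.sum_congr rfl fun _ _ => by rw [map_smul, smul_eq_mul]; ring

lemma bf_smul_right (c : ℚ) (x z : D.V) : D.bf x (c • z) = c * D.bf x z := by
  rw [bf_comm, bf_smul_left, bf_comm]

lemma srefl_self {β : D.V} (h : β ∈ D.roots) : D.act (D.srefl β) β = -β := by
  rw [D.srefl_apply β h, D.coroot_self β h]; module

lemma bf_coroot {β : D.V} (h : β ∈ D.roots) (x : D.V) :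
    2 * D.bf x β = D.coroot β x * D.bf β β := by
  have h1 := D.bf_act (D.srefl β) x β
  rw [D.srefl_self h, D.srefl_apply β h] at h1
  have h2 : -β = (-1 : ℚ) • β := by module
  rw [h2, bf_smul_right, bf_sub_left, bf_smul_left] at h1
  linarith

lemma coroot_smul {β : D.V} {c : ℚ} (h : β ∈ D.roots) (h' : c • β ∈ D.roots) (x : D.V) :
    D.coroot (c • β) x = c⁻¹ * D.coroot β x := by
  have hc : c ≠ 0 := by
    rintro rfl
    exact D.root_ne_zero h' (by simp)
  have h1 := D.bf_coroot h x
  have h2 := D.bf_coroot h' x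
  rw [bf_smul_right, bf_smul_right, bf_smul_left] at h2
  have h3 := D.bf_self_pos h
  have : (D.coroot (c • β) x * c - D.coroot β x) * (c * D.bf β β) = 0 := by
    linear_combination -h2 + c * h1
  have h4 : D.coroot (c • β) x * c - D.coroot β x = 0 := by
    rcases mul_eq_zero.mp this with h | h
    · exact h
    · exact absurd h (mul_ne_zero hc h3.ne')
  field_simp
  linarith

lemma coroot_neg {β : D.V} (h : β ∈ D.roots) (x : D.V) :
    D.coroot (-β) x = - D.coroot β x := by
  have h2 : -β = (-1 : ℚ) • β := by module
  have h3 := D.roots_neg β h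
  rw [h2] at h3 ⊢
  rw [D.coroot_smul h h3]; norm_num

lemma w_ext {g h : D.W} (H : ∀ x, D.act g x = D.act h x) : g = h := by
  have : h⁻¹ * g = 1 := D.act_faithful _ fun x => by
    rw [act_mul, H, act_inv_act]
  rw [inv_mul_eq_one] at this
  exact this.symm

lemma srefl_smul {β : D.V} {c : ℚ} (h : β ∈ D.roots) (h' : c • β ∈ D.roots) :
    D.srefl (c • β) = D.srefl β := by
  have hc : c ≠ 0 := by
    rintro rfl
    exact D.root_ne_zero h' (by simp)
  refine D.w_ext fun x => ?_
  rw [D.srefl_apply _ h, D.srefl_apply _ h', D.coroot_smul h h', smul_smul]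
  congr 2
  field_simp

lemma srefl_neg {β : D.V} (h : β ∈ D.roots) : D.srefl (-β) = D.srefl β := by
  have h2 : -β = (-1 : ℚ) • β := by module
  have h3 := D.roots_neg β h
  rw [h2] at h3 ⊢
  exact D.srefl_smul h h3

lemma srefl_conj (g : D.W) {β : D.V} (h : β ∈ D.roots) :
    D.srefl (D.act g β) = g * D.srefl β * g⁻¹ := by
  refine D.w_ext fun x => ?_
  have := D.coroot_equivariant g β h (D.act g⁻¹ x)
  rw [act_act_inv] at this
  rw [D.srefl_apply _ (D.roots_invariant g β h), act_mul, act_mul, D.srefl_apply _ h, map_sub,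
    act_act_inv, map_smul, this]

lemma srefl_sq {β : D.V} (h : β ∈ D.roots) : D.srefl β * D.srefl β = 1 := by
  refine D.w_ext fun x => ?_
  rw [act_mul, act_one, D.srefl_apply _ h, D.srefl_apply _ h, map_sub, map_smul,
    D.coroot_self _ h]
  simp only [smul_eq_mul]
  module

lemma srefl_inv {β : D.V} (h : β ∈ D.roots) : (D.srefl β)⁻¹ = D.srefl β :=
  inv_eq_of_mul_eq_one_left (D.srefl_sq h)

lemma coroot_act (g : D.W) {β : D.V} (h : β ∈ D.roots) (x : D.V) :
    D.coroot β (D.act g x) = D.coroot (D.act g⁻¹ β) x := by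
  have := D.coroot_equivariant g⁻¹ β h (D.act g x)
  rw [act_inv_act] at this
  exact this.symm

lemma coroot_act' (g : D.W) {β : D.V} (h : β ∈ D.roots) (x : D.V) :
    D.coroot (D.act g β) x = D.coroot β (D.act g⁻¹ x) := by
  have := D.coroot_act g⁻¹ h x
  rw [inv_inv] at this
  exact this.symm

/-- conjugates of simple roots -/
def Phi (β : D.V) : Prop := ∃ g i, β = D.act g (D.simple i)

/-- positive conjugates of simple roots -/
def PP (β : D.V) : Prop := D.Phi β ∧ ∀ i, 0 ≤ D.coef β i

variable {D}

lemma Phi.mem {β : D.V} (h : D.Phi β) : β ∈ D.roots := by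
  obtain ⟨g, i, rfl⟩ := h
  exact D.roots_invariant _ _ (D.simple_mem i)

lemma PP.mem {β : D.V} (h : D.PP β) : β ∈ D.roots := h.1.mem

lemma PP.isPos {β : D.V} (h : D.PP β) : D.IsPosRoot β :=
  D.isPosRoot_iff.mpr ⟨h.mem, h.2⟩

lemma Phi.act {β : D.V} (h : D.Phi β) (g : D.W) : D.Phi (D.act g β) := by
  obtain ⟨x, i, rfl⟩ := h
  exact ⟨g * x, i, by rw [act_mul]⟩

variable (D) in
lemma phi_simple (i : D.I) : D.Phi (D.simple i) := ⟨1, i, by rw [act_one]⟩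

variable (D) in
lemma pp_simple (i : D.I) : D.PP (D.simple i) :=
  ⟨D.phi_simple i, fun j => by rw [coef_simple]; split_ifs <;> norm_num⟩

lemma Phi.neg {β : D.V} (h : D.Phi β) : D.Phi (-β) := by
  rw [← D.srefl_self h.mem]; exact h.act _

lemma Phi.pos_or {β : D.V} (h : D.Phi β) : D.PP β ∨ D.PP (-β) := by
  rcases D.pos_or_neg h.mem with h1 | h1
  · exact Or.inl ⟨h, h1⟩
  · refine Or.inr ⟨h.neg, fun i => ?_⟩
    rw [map_neg, Pi.neg_apply]
    have := h1 i
    linarith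

lemma PP.not_neg {β : D.V} (h : D.PP β) (h' : D.PP (-β)) : False := by
  apply D.root_ne_zero h.mem
  rw [← D.root_expand h.mem]
  refine Finset.sum_eq_zero fun i _ => ?_
  have h1 := h.2 i
  have h2 := h'.2 i
  rw [map_neg, Pi.neg_apply] at h2
  have : D.coef β i = 0 := by linarith
  rw [this, zero_smul]

lemma coroot_phi (hsl : D.SimplyLaced) {β : D.V} (h : D.Phi β) (x : D.V) :
    D.coroot β x = ∑ i, D.coef β i * D.coroot (D.simple i) x := by
  obtain ⟨g, i, rfl⟩ := h
  obtain ⟨l, rfl⟩ := D.generated g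
  induction l generalizing x with
  | nil =>
    simp [coef_simple]
  | cons k t ih =>
    simp only [List.map_cons, List.prod_cons, act_mul]
    set β := D.act (List.map (fun i => D.srefl (D.simple i)) t).prod (D.simple i) with hβ
    have hm : β ∈ D.roots := D.roots_invariant _ _ (D.simple_mem i)
    have hk := D.simple_mem k
    rw [D.coroot_act' _ hm, D.srefl_inv hk, D.srefl_apply _ hk, D.srefl_apply _ hk, map_sub,
      map_smul, ih x, ih (D.simple k)]
    have e : ∑ j, D.coef β j * D.coroot (D.simple j) (D.simple k) = D.coroot (D.simple k) β := by
      conv_rhs => rw [← D.root_expand hm]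
      rw [map_sum]
      refine Finset.sum_congr rfl fun j _ => ?_
      rw [map_smul, smul_eq_mul, hsl j k]
    rw [e, map_sub, map_smul]
    simp only [Pi.sub_apply, Pi.smul_apply, coef_simple, smul_eq_mul, sub_mul,
      Finset.sum_sub_distrib]
    simp
    ring

lemma phi_symm (hsl : D.SimplyLaced) {β γ : D.V} (hβ : D.Phi β) (hγ : D.Phi γ) :
    D.coroot β γ = D.coroot γ β := by
  rw [coroot_phi hsl hβ, coroot_phi hsl hγ]
  have e1 : ∀ i, D.coroot (D.simple i) γ = ∑ j, D.coef γ j * D.coroot (D.simple i) (D.simple j) := by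
    intro i
    conv_lhs => rw [← D.root_expand hγ.mem]
    simp
  have e2 : ∀ i, D.coroot (D.simple i) β = ∑ j, D.coef β j * D.coroot (D.simple i) (D.simple j) := by
    intro i
    conv_lhs => rw [← D.root_expand hβ.mem]
    simp
  simp only [e1, e2, Finset.mul_sum]
  rw [Finset.sum_comm]
  refine Finset.sum_congr rfl fun i _ => Finset.sum_congr rfl fun j _ => ?_
  rw [hsl i j]; ring

lemma phi_add {β γ : D.V} (hβ : D.Phi β) (hγ : D.Phi γ)
    (h : D.coroot β γ = -1) : D.Phi (β + γ) := by
  have : β + γ = D.act (D.srefl β) γ := by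
    rw [D.srefl_apply _ hβ.mem, h]; module
  rw [this]; exact hγ.act _

lemma coroot_add (hsl : D.SimplyLaced) {β γ : D.V} (hβ : D.Phi β) (hγ : D.Phi γ)
    (h : D.Phi (β + γ)) (x : D.V) : D.coroot (β + γ) x = D.coroot β x + D.coroot γ x := by
  rw [coroot_phi hsl hβ, coroot_phi hsl hγ, coroot_phi hsl h, ← Finset.sum_add_distrib]
  refine Finset.sum_congr rfl fun i _ => ?_
  rw [map_add, Pi.add_apply]; ring

lemma pp_prop (hsl : D.SimplyLaced) {β γ : D.V} (hβ : D.PP β) (hγ : D.PP γ) {c : ℚ}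
    (h : β = c • γ) : β = γ := by
  have hm := hβ.mem
  rw [h] at hm
  have h1 := D.coroot_self _ hβ.mem
  rw [coroot_phi hsl hβ.1, h] at h1
  simp only [map_smul, Pi.smul_apply, smul_eq_mul] at h1
  have h2 : ∑ i, c * D.coef γ i * (c * D.coroot (D.simple i) γ) = c ^ 2 * D.coroot γ γ := by
    rw [coroot_phi hsl hγ.1, Finset.mul_sum]
    exact Finset.sum_congr rfl fun _ _ => by ring
  rw [h2, D.coroot_self _ hγ.mem] at h1
  have h3 : (c - 1) * (c + 1) = 0 := by linarith
  rcases mul_eq_zero.mp h3 with h4 | h4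
  · have : c = 1 := by linarith
    rw [h, this, one_smul]
  · have : c = -1 := by linarith
    exfalso
    apply hγ.not_neg
    have : -γ = β := by rw [h, this]; module
    rw [this]; exact hβ

lemma s_pos {β : D.V} (hβ : D.IsPosRoot β) (i : D.I) (hn : ¬ ∃ c : ℚ, β = c • D.simple i) :
    D.IsPosRoot (D.act (D.s i) β) := by
  rw [isPosRoot_iff] at hβ ⊢
  refine ⟨D.roots_invariant _ _ hβ.1, ?_⟩
  have : ∃ j, j ≠ i ∧ D.coef β j ≠ 0 := by
    by_contra! hc
    apply hn
    refine ⟨D.coef β i, ?_⟩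
    conv_lhs => rw [← D.root_expand hβ.1]
    rw [Finset.sum_eq_single i]
    · intro j _ hj
      rw [hc j hj, zero_smul]
    · simp
  obtain ⟨j, hj, hj0⟩ := this
  rcases D.pos_or_neg (D.roots_invariant (D.s i) _ hβ.1) with h | h
  · exact h
  · exfalso
    have h1 := h j
    unfold s at h1
    rw [D.srefl_apply _ (D.simple_mem i), map_sub, map_smul, Pi.sub_apply, Pi.smul_apply,
      coef_simple, if_neg hj, smul_zero, sub_zero] at h1
    exact hj0 (le_antisymm h1 (hβ.2 j))

lemma pp_s (hsl : D.SimplyLaced) {β : D.V} (hβ : D.PP β) (i : D.I) (hn : β ≠ D.simple i) :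
    D.PP (D.act (D.s i) β) := by
  refine ⟨hβ.1.act _, ?_⟩
  refine (D.isPosRoot_iff.mp (s_pos hβ.isPos i ?_)).2
  rintro ⟨c, hc⟩
  exact hn (pp_prop hsl hβ (D.pp_simple i) hc)

lemma exists_pos_pairing {β : D.V} (hβ : D.IsPosRoot β) : ∃ i, 0 < D.coroot (D.simple i) β := by
  rw [isPosRoot_iff] at hβ
  by_contra! h
  have h1 := D.bf_self_pos hβ.1
  have h2 : D.bf β β = ∑ i, D.coef β i * D.bf β (D.simple i) := by
    have : ∀ x, D.bf x β = ∑ i, D.coef β i * D.bf x (D.simple i) := by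
      intro x
      unfold bf
      simp only [Finset.mul_sum]
      rw [Finset.sum_comm]
      refine Finset.sum_congr rfl fun γ _ => ?_
      conv_lhs => rw [← D.root_expand hβ.1]
      rw [map_sum, Finset.mul_sum]
      refine Finset.sum_congr rfl fun i _ => ?_
      rw [map_smul, smul_eq_mul]; ring
    exact this β
  have h3 : D.bf β β ≤ 0 := by
    rw [h2]
    refine Finset.sum_nonpos fun i _ => ?_
    have h4 := D.bf_coroot (D.simple_mem i) β
    have h5 := D.bf_self_pos (D.simple_mem i)
    have h6 := h i
    have : D.bf β (D.simple i) ≤ 0 := by nlinarith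
    exact mul_nonpos_of_nonneg_of_nonpos (hβ.2 i) this
  linarith

variable (D) in
/-- height functional -/
noncomputable def hgt : D.V →ₗ[ℚ] ℚ where
  toFun x := ∑ i, D.coef x i
  map_add' x y := by simp [Finset.sum_add_distrib]
  map_smul' c x := by simp [Finset.mul_sum]

variable (D) in
lemma hgt_simple (i : D.I) : D.hgt (D.simple i) = 1 := by
  simp [hgt, coef_simple]

lemma hgt_nat {β : D.V} (h : D.IsPosRoot β) : ∃ n : ℕ, 1 ≤ n ∧ D.hgt β = n := by
  have h1 := D.posCoeff_spec β h.1 h.2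
  have h2 : D.hgt β = ((∑ i, D.posCoeff β i : ℕ) : ℚ) := by
    have : D.coef β = fun i => (D.posCoeff β i : ℚ) := by
      conv_lhs => rw [h1]
      rw [coef_comb D (fun i => (D.posCoeff β i : ℚ))]
    simp [hgt, this]
  refine ⟨_, ?_, h2⟩
  rw [Nat.one_le_iff_ne_zero]
  intro h3
  apply D.root_ne_zero h.1
  rw [h1]
  refine Finset.sum_eq_zero fun i hi => ?_
  rw [Finset.sum_eq_zero_iff] at h3
  rw [h3 i hi]; simp

lemma PP.one_le_hgt {β : D.V} (h : D.PP β) : 1 ≤ D.hgt β := by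
  obtain ⟨n, h1, h2⟩ := hgt_nat h.isPos
  rw [h2]; exact_mod_cast h1

/-- every positive root is a multiple `≥ 1` of a conjugate of a simple root -/
lemma root_mult {β : D.V} (h : D.IsPosRoot β) :
    ∃ γ, ∃ c : ℚ, D.PP γ ∧ 1 ≤ c ∧ β = c • γ := by
  have key : ∀ n : ℕ, ∀ β, D.IsPosRoot β → D.hgt β = n →
      ∃ γ, ∃ c : ℚ, D.PP γ ∧ 0 < c ∧ β = c • γ := by
    intro n
    induction n using Nat.strong_induction_on with
    | _ n ih =>
      intro β hβ hn
      obtain ⟨i, hi⟩ := exists_pos_pairing hβ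
      by_cases hp : ∃ c : ℚ, β = c • D.simple i
      · obtain ⟨c, hc⟩ := hp
        refine ⟨_, c, D.pp_simple i, ?_, hc⟩
        rw [hc, map_smul, D.coroot_self _ (D.simple_mem i), smul_eq_mul] at hi
        linarith
      · have h1 := s_pos hβ i hp
        obtain ⟨m, hm1, hm⟩ := hgt_nat h1
        have h2 : D.hgt (D.act (D.s i) β) = D.hgt β - D.coroot (D.simple i) β := by
          unfold s
          rw [D.srefl_apply _ (D.simple_mem i), map_sub, map_smul, hgt_simple]; simp
        have hmn : m < n := by
          have : (m : ℚ) < n := by rw [← hm, ← hn, h2]; linarith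
          exact_mod_cast this
        obtain ⟨γ, c, hγ, hc, e⟩ := ih m hmn _ h1 hm
        have e2 : β = c • D.act (D.s i) γ := by
          rw [← map_smul, ← e, ← act_mul]
          unfold s
          rw [D.srefl_sq (D.simple_mem i), act_one]
        refine ⟨_, c, ⟨hγ.1.act _, fun j => ?_⟩, hc, e2⟩
        have := (D.isPosRoot_iff.mp hβ).2 j
        rw [e2, map_smul, Pi.smul_apply, smul_eq_mul] at this
        exact (mul_nonneg_iff_of_pos_left hc).mp this
  obtain ⟨n, -, hn⟩ := hgt_nat h
  obtain ⟨γ, c, hγ, hc, e⟩ := key n β h hn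
  refine ⟨γ, c, hγ, ?_, e⟩
  obtain ⟨g, i, hg⟩ := hγ.1
  have h1 : D.act g⁻¹ β = c • D.simple i := by
    rw [e, hg, map_smul, act_inv_act]
  have h2 : D.IsPosRoot (c • D.simple i) := by
    rw [isPosRoot_iff]
    refine ⟨h1 ▸ D.roots_invariant _ _ h.1, fun j => ?_⟩
    rw [map_smul, Pi.smul_apply, smul_eq_mul]
    exact mul_nonneg hc.le ((D.pp_simple i).2 j)
  obtain ⟨m, hm1, hm⟩ := hgt_nat h2
  rw [map_smul, hgt_simple, smul_eq_mul, mul_one] at hm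
  rw [hm]; exact_mod_cast hm1

end helper
end WeylSetting

namespace WeylSetting

section helper2
variable {D : WeylSetting}

/-! ### Words and length -/

lemma wordProd_nil : D.wordProd [] = 1 := rfl

lemma wordProd_cons (i : D.I) (t : List D.I) : D.wordProd (i :: t) = D.s i * D.wordProd t := by
  simp [wordProd]

lemma wordProd_append (t t' : List D.I) :
    D.wordProd (t ++ t') = D.wordProd t * D.wordProd t' := by
  simp [wordProd]

lemma s_mul_s (i : D.I) : D.s i * D.s i = 1 := D.srefl_sq (D.simple_mem i)

lemma s_inv (i : D.I) : (D.s i)⁻¹ = D.s i := D.srefl_inv (D.simple_mem i)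

lemma s_s_apply (i : D.I) (x : D.V) : D.act (D.s i) (D.act (D.s i) x) = x := by
  rw [← act_mul, s_mul_s, act_one]

lemma s_apply (i : D.I) (x : D.V) :
    D.act (D.s i) x = x - D.coroot (D.simple i) x • D.simple i :=
  D.srefl_apply _ (D.simple_mem i) x

lemma coroot_s (i : D.I) {β : D.V} (h : β ∈ D.roots) (x : D.V) :
    D.coroot β (D.act (D.s i) x) = D.coroot (D.act (D.s i) β) x := by
  rw [D.coroot_act _ h, s_inv]

lemma length_le {l : List D.I} {g : D.W} (h : D.wordProd l = g) : D.length g ≤ l.length :=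
  Nat.sInf_le ⟨l, rfl, h⟩

lemma exists_reduced (g : D.W) : ∃ l, D.IsReduced l g := by
  have hne : {n | ∃ l : List D.I, l.length = n ∧ D.wordProd l = g}.Nonempty := by
    obtain ⟨l, hl⟩ := D.generated g
    exact ⟨l.length, l, rfl, hl.symm⟩
  obtain ⟨l, h1, h2⟩ := Nat.sInf_mem hne
  exact ⟨l, h2, h1⟩

lemma exchange (hsl : D.SimplyLaced) (l : List D.I) {δ : D.V} (hδ : D.PP δ)
    (h : D.PP (-(D.act (D.wordProd l) δ))) :
    ∃ l' : List D.I, l'.length < l.length ∧ D.wordProd l' = D.wordProd l * D.srefl δ := by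
  induction l with
  | nil =>
    rw [wordProd_nil, act_one] at h
    exact (hδ.not_neg h).elim
  | cons i t ih =>
    rcases (hδ.1.act (D.wordProd t)).pos_or with h1 | h1
    · by_cases h2 : D.act (D.wordProd t) δ = D.simple i
      · refine ⟨t, by simp, ?_⟩
        have h3 := D.srefl_conj (D.wordProd t) hδ.mem
        rw [h2] at h3
        have h4 : D.s i = D.wordProd t * D.srefl δ * (D.wordProd t)⁻¹ := h3
        have h5 : D.wordProd t * D.srefl δ = D.s i * D.wordProd t := by
          rw [h4]; group
        rw [wordProd_cons, mul_assoc, h5, ← mul_assoc, s_mul_s, one_mul]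
      · exfalso
        have h3 := pp_s hsl h1 i h2
        rw [wordProd_cons, act_mul] at h
        exact h3.not_neg h
    · obtain ⟨l', h2, h3⟩ := ih h1
      refine ⟨i :: l', by simpa using h2, ?_⟩
      rw [wordProd_cons, wordProd_cons, h3, mul_assoc]

lemma len_lt (hsl : D.SimplyLaced) {x : D.W} {δ : D.V} (hδ : D.PP δ)
    (h : D.PP (-(D.act x δ))) : D.length (x * D.srefl δ) < D.length x := by
  obtain ⟨l, h1, h2⟩ := exists_reduced x
  subst h1
  obtain ⟨l', h3, h4⟩ := exchange hsl l hδ h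
  have := length_le h4
  omega

lemma len_gt (hsl : D.SimplyLaced) {x : D.W} {δ : D.V} (hδ : D.PP δ)
    (h : D.PP (D.act x δ)) : D.length x < D.length (x * D.srefl δ) := by
  have := len_lt hsl (x := x * D.srefl δ) hδ (by
    rw [act_mul, D.srefl_self hδ.mem, map_neg, neg_neg]; exact h)
  rwa [mul_assoc, D.srefl_sq hδ.mem, mul_one] at this

lemma srefl_mul_eq (x : D.W) {β : D.V} (h : β ∈ D.roots) :
    D.srefl β * x = x * D.srefl (D.act x⁻¹ β) := by
  rw [D.srefl_conj _ h]; group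

lemma len_lt_left (hsl : D.SimplyLaced) {x : D.W} {β : D.V} (hβ : D.PP β)
    (h : D.PP (-(D.act x⁻¹ β))) : D.length (D.srefl β * x) < D.length x := by
  rw [srefl_mul_eq x hβ.mem, ← D.srefl_neg (D.roots_invariant _ _ hβ.mem)]
  apply len_lt hsl h
  rw [map_neg, act_act_inv, neg_neg]; exact hβ

lemma len_gt_left (hsl : D.SimplyLaced) {x : D.W} {β : D.V} (hβ : D.PP β)
    (h : D.PP (D.act x⁻¹ β)) : D.length x < D.length (D.srefl β * x) := by
  rw [srefl_mul_eq x hβ.mem]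
  apply len_gt hsl h
  rw [act_act_inv]; exact hβ

lemma bruhat_len {a b : D.W} (h : D.bruhatLE a b) : a = b ∨ D.length a < D.length b := by
  induction h with
  | refl => exact Or.inl rfl
  | tail _ h2 ih =>
    rcases ih with rfl | ih
    · exact Or.inr h2.2
    · exact Or.inr (ih.trans h2.2)

lemma bruhat_len_le {a b : D.W} (h : D.bruhatLE a b) : D.length a ≤ D.length b := by
  rcases bruhat_len h with rfl | h
  · exact le_rfl
  · exact h.le

/-! ### Simply laced facts -/

lemma bf_zero_of_self {z : D.V} (h : D.bf z z = 0) (x : D.V) : D.bf z x = 0 := by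
  unfold bf at h ⊢
  rw [Finset.sum_eq_zero_iff_of_nonneg (fun _ _ => mul_self_nonneg _)] at h
  refine Finset.sum_eq_zero fun γ hγ => ?_
  rw [mul_self_eq_zero.mp (h γ hγ), zero_mul]

lemma eq_of_coroot_eq {β γ : D.V} (hβ : β ∈ D.roots) (hγ : γ ∈ D.roots)
    (h : ∀ x, D.coroot β x = D.coroot γ x) : β = γ := by
  by_contra hne
  have hmem : ∀ n : ℕ, β + (2 * n : ℚ) • (γ - β) ∈ D.roots := by
    intro n
    induction n with
    | zero => simpa using hβ
    | succ n ih =>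
      have h1 := D.roots_invariant (D.srefl γ * D.srefl β) _ ih
      have h2 := D.coroot_self β hβ
      have h3 := D.coroot_self γ hγ
      have h4 : D.coroot β γ = 2 := by rw [h, h3]
      have h5 : D.coroot γ β = 2 := by rw [← h, h2]
      convert h1 using 1
      rw [act_mul, D.srefl_apply _ hβ, D.srefl_apply _ hγ]
      simp only [map_add, map_sub, map_smul, h2, h3, h4, h5, smul_eq_mul]
      push_cast
      module
  refine Set.infinite_of_injective_forall_mem (s := (D.roots : Set D.V)) (f := fun n : ℕ =>
    β + (2 * n : ℚ) • (γ - β)) ?_ (fun n => hmem n) D.roots.finite_toSet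
  intro a b hab
  simp only [add_right_inj] at hab
  have h6 : γ - β ≠ 0 := sub_ne_zero.mpr (Ne.symm hne)
  have := smul_left_injective ℚ h6 hab
  have h7 : (a : ℚ) = b := by linarith
  exact_mod_cast h7

lemma phi_le_one (hsl : D.SimplyLaced) {β γ : D.V} (hβ : D.Phi β) (hγ : D.Phi γ)
    (hne : β ≠ γ) : D.coroot β γ ≤ 1 := by
  obtain ⟨n, hn⟩ := D.crystallographic β hβ.mem γ hγ.mem
  by_contra hlt
  push Not at hlt
  have hn2 : 2 ≤ n := by
    have : (1 : ℚ) < n := by rw [← hn]; exact hlt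
    have : 1 < n := by exact_mod_cast this
    omega
  have hnq : (2 : ℚ) ≤ n := by exact_mod_cast hn2
  have h1 := D.bf_coroot hβ.mem γ
  have h2 := D.bf_coroot hγ.mem β
  rw [← phi_symm hsl hβ hγ, D.bf_comm β γ] at h2
  rw [hn] at h1 h2
  have hN : D.bf β β = D.bf γ γ := by
    have : (n : ℚ) * (D.bf β β - D.bf γ γ) = 0 := by linarith
    rcases mul_eq_zero.mp this with h | h
    · linarith
    · linarith
  have hp := D.bf_self_pos hβ.mem
  have h3 : D.bf (β - γ) (β - γ) = D.bf β β * (2 - n) := by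
    rw [bf_sub_left, D.bf_comm β, D.bf_comm γ, bf_sub_left, bf_sub_left, D.bf_comm β γ, ← hN]
    linarith
  have h4 := D.bf_self_nonneg (β - γ)
  have h5 : (n : ℚ) = 2 := by nlinarith
  rw [h5] at h3
  have h6 : D.bf (β - γ) (β - γ) = 0 := by rw [h3]; ring
  apply hne
  refine eq_of_coroot_eq hβ.mem hγ.mem fun x => ?_
  have h7 := bf_zero_of_self h6 x
  rw [bf_sub_left] at h7
  have h8 := D.bf_coroot hβ.mem x
  have h9 := D.bf_coroot hγ.mem x
  rw [D.bf_comm x] at h8 h9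
  have : (D.coroot β x - D.coroot γ x) * D.bf β β = 0 := by
    rw [← hN] at h9; linarith
  rcases mul_eq_zero.mp this with h | h
  · linarith
  · linarith

lemma pp_ge_neg_one (hsl : D.SimplyLaced) {β γ : D.V} (hβ : D.PP β) (hγ : D.PP γ) :
    -1 ≤ D.coroot β γ := by
  have := phi_le_one hsl hβ.1 hγ.1.neg (by
    intro h
    apply hγ.not_neg
    rw [← h]; exact hβ)
  rw [map_neg] at this
  linarith

lemma PP.add (hsl : D.SimplyLaced) {β γ : D.V} (hβ : D.PP β) (hγ : D.PP γ)
    (h : D.coroot β γ = -1) : D.PP (β + γ) := by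
  refine ⟨phi_add hβ.1 hγ.1 h, fun i => ?_⟩
  rw [map_add, Pi.add_apply]
  exact add_nonneg (hβ.2 i) (hγ.2 i)

/-! ### Predominant weights and paths of weights -/

variable (D) in
/-- pre-dominance on conjugates of simple roots -/
def Pre (a : D.V) : Prop := ∀ γ, D.PP γ → ∃ n : ℤ, D.coroot γ a = n ∧ -1 ≤ n

variable (D) in
/-- one step in the graph of weights -/
def Step (a b : D.V) : Prop := ∃ β, D.PP β ∧ D.coroot β a = -1 ∧ b = a + β

variable (D) in
/-- one simple step in the graph of weights -/
def SStep (a b : D.V) : Prop := ∃ i, D.coroot (D.simple i) a = -1 ∧ b = a + D.simple i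

variable (D) in
/-- reachability in the graph of weights -/
def Reach : D.V → D.V → Prop := Relation.ReflTransGen D.Step

lemma pre_step (hsl : D.SimplyLaced) {a b : D.V} (ha : D.Pre a) (h : D.Step a b) : D.Pre b := by
  obtain ⟨β, hβ, h1, rfl⟩ := h
  intro γ hγ
  obtain ⟨n, hn, hn1⟩ := ha γ hγ
  obtain ⟨m, hm⟩ := D.crystallographic γ hγ.mem β hβ.mem
  refine ⟨n + m, by rw [map_add, hn, hm]; push_cast; ring, ?_⟩
  have h2 := pp_ge_neg_one hsl hγ hβ
  rw [hm] at h2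
  have h3 : -1 ≤ m := by exact_mod_cast h2
  by_contra hc
  have h4 : n = -1 := by omega
  have h5 : m = -1 := by omega
  subst h4 h5
  have hm' : D.coroot γ β = -1 := by rw [hm]; norm_num
  have h6 := hγ.add hsl hβ hm'
  obtain ⟨k, hk, hk1⟩ := ha _ h6
  rw [coroot_add hsl hγ.1 hβ.1 h6.1, hn, h1] at hk
  have : k = -2 := by
    have : (k : ℚ) = (-2 : ℤ) := by rw [← hk]; norm_num
    exact_mod_cast this
  omega

lemma pre_reach (hsl : D.SimplyLaced) {a b : D.V} (ha : D.Pre a) (h : D.Reach a b) : D.Pre b := by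
  induction h with
  | refl => exact ha
  | tail _ h2 ih => exact pre_step hsl ih h2

lemma reach_hgt {a b : D.V} (h : D.Reach a b) : a = b ∨ D.hgt a + 1 ≤ D.hgt b := by
  induction h with
  | refl => exact Or.inl rfl
  | tail _ h2 ih =>
    obtain ⟨β, hβ, -, rfl⟩ := h2
    have := hβ.one_le_hgt
    right
    rw [map_add]
    rcases ih with rfl | ih
    · linarith
    · linarith

lemma sstep_step {a b : D.V} (h : D.SStep a b) : D.Step a b := by
  obtain ⟨i, h1, h2⟩ := h
  exact ⟨_, D.pp_simple i, h1, h2⟩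

lemma step_sreach (hsl : D.SimplyLaced) {a β : D.V} (ha : D.Pre a) (hβ : D.PP β)
    (h : D.coroot β a = -1) : Relation.ReflTransGen D.SStep a (a + β) := by
  have key : ∀ n : ℕ, ∀ a β, D.Pre a → D.PP β → D.coroot β a = -1 → D.hgt β = n →
      Relation.ReflTransGen D.SStep a (a + β) := by
    intro n
    induction n with
    | zero =>
      intro a β _ hβ _ h0
      have := hβ.one_le_hgt
      rw [h0] at this
      norm_num at this
    | succ n ih =>
      intro a β ha hβ h hn
      obtain ⟨i, hi⟩ := exists_pos_pairing hβ.isPos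
      by_cases hs : β = D.simple i
      · subst hs
        exact Relation.ReflTransGen.single ⟨i, h, rfl⟩
      · have h1 : D.coroot (D.simple i) β = 1 := by
          have h2 := phi_le_one hsl (D.phi_simple i) hβ.1 (Ne.symm hs)
          obtain ⟨m, hm⟩ := D.crystallographic _ (D.simple_mem i) β hβ.mem
          rw [hm] at h2 hi ⊢
          have h3 : m ≤ 1 := by exact_mod_cast h2
          have h4 : 0 < m := by exact_mod_cast hi
          have : m = 1 := by omega
          rw [this]; norm_num
        have h1' : D.coroot β (D.simple i) = 1 := by
          rw [phi_symm hsl hβ.1 (D.phi_simple i), h1]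
        set γ := D.act (D.s i) β with hγdef
        have hγ : D.PP γ := pp_s hsl hβ i hs
        have hγe : γ = β - D.simple i := by
          rw [hγdef, s_apply, h1, one_smul]
        have hβe : β = γ + D.simple i := by rw [hγe]; abel
        have hγn : D.hgt γ = n := by
          rw [hγe, map_sub, hn, hgt_simple]; push_cast; ring
        have hsum : D.coroot β a = D.coroot γ a + D.coroot (D.simple i) a := by
          have := coroot_add hsl hγ.1 (D.phi_simple i) (by rw [← hβe]; exact hβ.1) a
          rw [← hβe] at this
          exact this
        have hαγ : D.coroot (D.simple i) γ = -1 := by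
          rw [hγe, map_sub, h1, D.coroot_self _ (D.simple_mem i)]; norm_num
        obtain ⟨p, hp, hp1⟩ := ha γ hγ
        obtain ⟨q, hq, hq1⟩ := ha _ (D.pp_simple i)
        have hpq : p + q = -1 := by
          have : ((p + q : ℤ) : ℚ) = ((-1 : ℤ) : ℚ) := by
            push_cast; rw [← hp, ← hq, ← hsum, h]
          exact_mod_cast this
        by_cases hq2 : q = -1
        · have hst : D.SStep a (a + D.simple i) := ⟨i, by rw [hq, hq2]; norm_num, rfl⟩
          have hp0 : p = 0 := by omega
          have := ih (a + D.simple i) γ (pre_step hsl ha (sstep_step hst)) hγ (by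
            rw [map_add, hp, hp0, phi_symm hsl hγ.1 (D.phi_simple i), hαγ]; norm_num) hγn
          have e : a + β = a + D.simple i + γ := by rw [hγe]; abel
          rw [e]
          exact Relation.ReflTransGen.head hst this
        · have hq0 : q = 0 := by omega
          have hp0 : p = -1 := by omega
          have := ih a γ ha hγ (by rw [hp, hp0]; norm_num) hγn
          refine this.tail ⟨i, ?_, ?_⟩
          · rw [map_add, hq, hq0, hαγ]; norm_num
          · rw [hβe]; abel
  obtain ⟨n, -, hn⟩ := hgt_nat hβ.isPos
  exact key n a β ha hβ h hn

lemma reach_sreach (hsl : D.SimplyLaced) {a b : D.V} (ha : D.Pre a) (h : D.Reach a b) :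
    Relation.ReflTransGen D.SStep a b := by
  induction h with
  | refl => exact Relation.ReflTransGen.refl
  | tail h1 h2 ih =>
    obtain ⟨β, hβ, h3, rfl⟩ := h2
    exact ih.trans (step_sreach hsl (pre_reach hsl ha h1) hβ h3)

variable (D) in
/-- the word `l` acts on `b` by lowering minuscule steps -/
def Chn (b : D.V) : List D.I → Prop
  | [] => True
  | i :: t => D.coroot (D.simple i) (D.act (D.wordProd t) b) = 1 ∧ Chn b t

lemma sreach_chn {a b : D.V} (h : Relation.ReflTransGen D.SStep a b) :
    ∃ l, D.Chn b l ∧ D.act (D.wordProd l) b = a := by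
  induction h using Relation.ReflTransGen.head_induction_on with
  | refl => exact ⟨[], trivial, by rw [wordProd_nil, act_one]⟩
  | head h1 _ ih =>
    obtain ⟨l, h3, h4⟩ := ih
    obtain ⟨i, h5, h6⟩ := h1
    have h7 : D.coroot (D.simple i) (D.act (D.wordProd l) b) = 1 := by
      rw [h4, h6, map_add, h5, D.coroot_self _ (D.simple_mem i)]; norm_num
    refine ⟨i :: l, ⟨h7, h3⟩, ?_⟩
    rw [wordProd_cons, act_mul, s_apply, h7, h4, h6]
    module

lemma chn_of_minuscule {p : D.V} (l : List D.I)
    (h : ∀ k : Fin l.length,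
      D.coroot (D.simple (l.get k)) (D.act (D.wordProd (l.drop (k.val + 1))) p) = 1) :
    D.Chn p l := by
  induction l with
  | nil => trivial
  | cons i t ih =>
    refine ⟨?_, ih fun k => ?_⟩
    · simpa using h ⟨0, by simp⟩
    · simpa using h k.succ

lemma chn_inv (hsl : D.SimplyLaced) {b : D.V} (l : List D.I) (hl : D.Chn b l) {γ : D.V}
    (hγ : D.PP γ) (h : D.PP (-(D.act (D.wordProd l) γ))) : D.coroot γ b = 1 := by
  induction l with
  | nil =>
    rw [wordProd_nil, act_one] at h
    exact (hγ.not_neg h).elim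
  | cons i t ih =>
    rcases (hγ.1.act (D.wordProd t)).pos_or with h1 | h1
    · by_cases h2 : D.act (D.wordProd t) γ = D.simple i
      · have h3 := hl.1
        rwa [← h2, D.coroot_equivariant _ _ hγ.mem] at h3
      · exfalso
        have h3 := pp_s hsl h1 i h2
        rw [wordProd_cons, act_mul] at h
        exact h3.not_neg h
    · exact ih hl.2 h1

/-! ### Dominant weights -/

lemma dom_nonneg (hsl : D.SimplyLaced) {p : D.V} (hp : D.IsDominant p) {γ : D.V} (hγ : D.PP γ) :
    0 ≤ D.coroot γ p := by
  rw [coroot_phi hsl hγ.1]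
  exact Finset.sum_nonneg fun i _ => mul_nonneg (hγ.2 i) (hp.2 i)

lemma dom_int {p : D.V} (hp : D.IsDominant p) {γ : D.V} (hγ : γ ∈ D.roots) :
    ∃ n : ℤ, D.coroot γ p = n := by
  rcases D.root_pos_or_neg γ hγ with h | h
  · exact hp.1 γ ⟨hγ, h⟩
  · obtain ⟨n, hn⟩ := hp.1 (-γ) ⟨D.roots_neg _ hγ, h⟩
    rw [D.coroot_neg hγ] at hn
    exact ⟨-n, by push_cast; linarith⟩

lemma pre_of_minuscule (hsl : D.SimplyLaced) {p : D.V} (hp : D.IsDominant p) {w : D.W}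
    (hw : D.IsMinuscule p w) : D.Pre (D.act w p) := by
  obtain ⟨l, ⟨hl, -⟩, h⟩ := hw
  have hc := chn_of_minuscule l h
  intro γ hγ
  rw [D.coroot_act _ hγ.mem]
  obtain ⟨n, hn⟩ := dom_int hp (D.roots_invariant w⁻¹ γ hγ.mem)
  refine ⟨n, hn, ?_⟩
  rcases (hγ.1.act w⁻¹).pos_or with h1 | h1
  · have := dom_nonneg hsl hp h1
    rw [hn] at this
    have : 0 ≤ n := by exact_mod_cast this
    omega
  · have := chn_inv hsl l hc h1 (by
      rw [hl, map_neg, act_act_inv, neg_neg]; exact hγ)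
    rw [D.coroot_neg (D.roots_invariant w⁻¹ γ hγ.mem), hn] at this
    have h2 : (n : ℚ) = ((-1 : ℤ) : ℚ) := by push_cast; linarith
    have : n = -1 := by exact_mod_cast h2
    omega

variable (D) in
/-- root-theoretic criterion for minimal representatives -/
def MR (p : D.V) (x : D.W) : Prop := ∀ δ, D.PP δ → D.coroot δ p = 0 → D.PP (D.act x δ)

lemma mem_stab {p : D.V} {g : D.W} : g ∈ D.stab p ↔ D.act g p = p := Iff.rfl

lemma coset_iff {p : D.V} {a b : D.W} : a⁻¹ * b ∈ D.stab p ↔ D.act a p = D.act b p := by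
  rw [mem_stab, act_mul]
  constructor
  · intro h
    conv_lhs => rw [← h]
    rw [act_act_inv]
  · intro h
    rw [← h, act_inv_act]

lemma srefl_fix {p δ : D.V} (hδ : δ ∈ D.roots) (h : D.coroot δ p = 0) :
    D.act (D.srefl δ) p = p := by
  rw [D.srefl_apply _ hδ, h, zero_smul, sub_zero]

lemma mr_of_minRep (hsl : D.SimplyLaced) {p : D.V} {x : D.W} (h : D.IsMinRep (D.stab p) x) :
    D.MR p x := by
  intro δ hδ h0
  rcases (hδ.1.act x).pos_or with h1 | h1
  · exact h1
  · exfalso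
    have h2 := len_lt hsl hδ h1
    have h3 := h (x * D.srefl δ) (by
      rw [coset_iff, act_mul, srefl_fix hδ.mem h0])
    omega

lemma eq_one_of_pos (hsl : D.SimplyLaced) {x : D.W} (h : ∀ i, D.PP (D.act x (D.simple i))) :
    x = 1 := by
  obtain ⟨l, h1, h2⟩ := exists_reduced x
  rcases List.eq_nil_or_concat l with rfl | ⟨t, i, rfl⟩
  · exact h1.symm
  · exfalso
    have h3 := len_gt hsl (D.pp_simple i) (h i)
    have h4 : D.wordProd t = x * D.srefl (D.simple i) := by
      rw [← h1, List.concat_eq_append, wordProd_append]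
      simp only [wordProd_cons, wordProd_nil, mul_one]
      rw [mul_assoc]
      change _ = _ * (D.s i * D.s i)
      rw [s_mul_s, mul_one]
    have h5 := length_le h4
    simp at h2
    omega

lemma mr_unique (hsl : D.SimplyLaced) {p : D.V} (hp : D.IsDominant p) {x y : D.W}
    (hx : D.MR p x) (hy : D.MR p y) (h : D.act x p = D.act y p) : x = y := by
  have hg : D.act (x⁻¹ * y) p = p := coset_iff.mpr h
  have : x⁻¹ * y = 1 := by
    refine eq_one_of_pos hsl fun i => ?_
    have hδ := D.pp_simple i
    rcases (hδ.1.act (x⁻¹ * y)).pos_or with h1 | h1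
    · exact h1
    · exfalso
      have h2 : D.coroot (D.act (x⁻¹ * y) (D.simple i)) p = D.coroot (D.simple i) p := by
        conv_lhs => rw [← hg]
        rw [D.coroot_equivariant _ _ hδ.mem]
      have h3 := dom_nonneg hsl hp h1
      have h4 := dom_nonneg hsl hp hδ
      rw [D.coroot_neg (hδ.1.act _).mem, h2] at h3
      have h5 : D.coroot (D.simple i) p = 0 := by linarith
      have h6 := hy _ hδ h5
      have h7 := hx _ h1 (by rw [D.coroot_neg (hδ.1.act _).mem, h2, h5, neg_zero])
      rw [map_neg, act_mul, act_act_inv] at h7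
      exact h6.not_neg h7
  exact inv_mul_eq_one.mp this

lemma exists_mr (hsl : D.SimplyLaced) (p : D.V) (y : D.W) :
    ∃ x, D.MR p x ∧ D.act x p = D.act y p ∧ D.bruhatLE x y := by
  have key : ∀ n : ℕ, ∀ y, D.length y = n →
      ∃ x, D.MR p x ∧ D.act x p = D.act y p ∧ D.bruhatLE x y := by
    intro n
    induction n using Nat.strong_induction_on with
    | _ n ih =>
      intro y hn
      by_cases hy : D.MR p y
      · exact ⟨y, hy, rfl, Relation.ReflTransGen.refl⟩
      · unfold MR at hy
        push Not at hy
        obtain ⟨δ, hδ, h0, h1⟩ := hy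
        have h2 : D.PP (-(D.act y δ)) := (hδ.1.act y).pos_or.resolve_left h1
        have h3 := len_lt hsl hδ h2
        obtain ⟨x, hx, hx1, hx2⟩ := ih _ (hn ▸ h3) (y * D.srefl δ) rfl
        refine ⟨x, hx, ?_, hx2.tail ⟨⟨_, h2.isPos, ?_⟩, h3⟩⟩
        · rw [hx1, act_mul, srefl_fix hδ.mem h0]
        · rw [D.srefl_neg (hδ.1.act y).mem, D.srefl_conj _ hδ.mem]
          have := D.srefl_sq hδ.mem
          calc y = y * (D.srefl δ * D.srefl δ) := by rw [this, mul_one]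
            _ = _ := by group
  exact key _ y rfl

lemma minRep_of_mr (hsl : D.SimplyLaced) {p : D.V} (hp : D.IsDominant p) {x : D.W}
    (h : D.MR p x) : D.IsMinRep (D.stab p) x := by
  intro g hg
  rw [coset_iff] at hg
  obtain ⟨y, hy, hy1, hy2⟩ := exists_mr hsl p g
  have := mr_unique hsl hp h hy (hg.trans hy1.symm)
  rw [this]; exact bruhat_len_le hy2

/-! ### Bruhat order versus weights -/

lemma mr_chn (hsl : D.SimplyLaced) {p : D.V} (hp : D.IsDominant p) {v : D.W} (hv : D.MR p v)
    (l : List D.I) (hl : D.Chn (D.act v p) l) :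
    D.MR p (D.wordProd l * v) ∧ D.bruhatLE v (D.wordProd l * v) := by
  induction l with
  | nil => rw [wordProd_nil, one_mul]; exact ⟨hv, Relation.ReflTransGen.refl⟩
  | cons i t ih =>
    obtain ⟨h1, h2⟩ := ih hl.2
    have h3 := hl.1
    rw [← act_mul] at h3
    rw [wordProd_cons, mul_assoc]
    set x := D.wordProd t * v
    constructor
    · intro δ hδ h0
      rw [act_mul]
      apply pp_s hsl (h1 δ hδ h0)
      intro h4
      rw [← h4, D.coroot_equivariant _ _ hδ.mem, h0] at h3
      norm_num at h3
    · refine h2.tail ⟨⟨_, (D.pp_simple i).isPos, rfl⟩, ?_⟩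
      apply len_gt_left hsl (D.pp_simple i)
      rw [D.coroot_act _ (D.simple_mem i)] at h3
      rcases ((D.phi_simple i).act x⁻¹).pos_or with h4 | h4
      · exact h4
      · exfalso
        have := dom_nonneg hsl hp h4
        rw [D.coroot_neg (D.roots_invariant _ _ (D.simple_mem i)), h3] at this
        norm_num at this

lemma bruhat_reach (hsl : D.SimplyLaced) {p : D.V} (hp : D.IsDominant p) {a b : D.W}
    (h : D.bruhatLE a b) (hb : D.Pre (D.act b p)) : D.Reach (D.act b p) (D.act a p) := by
  induction h with
  | refl => exact Relation.ReflTransGen.refl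
  | @tail b c _ h2 ih =>
    obtain ⟨⟨β, hβ, rfl⟩, hlen⟩ := h2
    obtain ⟨γ, k, hγ, hk, rfl⟩ := root_mult hβ
    rw [D.srefl_smul hγ.mem hβ.1] at hb hlen ⊢
    have hneg : D.PP (D.act b⁻¹ γ) := by
      rcases (hγ.1.act b⁻¹).pos_or with h | h
      · exact h
      · have := len_lt_left hsl hγ h
        omega
    obtain ⟨n, hn, hn1⟩ := hb γ hγ
    have e : D.coroot γ (D.act (D.srefl γ * b) p) = - D.coroot γ (D.act b p) := by
      rw [act_mul, D.coroot_act _ hγ.mem, D.srefl_inv hγ.mem, D.srefl_self hγ.mem,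
        D.coroot_neg hγ.mem]
    have h3 : 0 ≤ D.coroot γ (D.act b p) := by
      rw [D.coroot_act _ hγ.mem]; exact dom_nonneg hsl hp hneg
    have h4 : D.act (D.srefl γ * b) p = D.act b p - D.coroot γ (D.act b p) • γ := by
      rw [act_mul, D.srefl_apply _ hγ.mem]
    have h5 : n ≤ 0 := by
      have : (n : ℚ) ≤ 0 := by rw [← hn, e]; linarith
      exact_mod_cast this
    rcases (by omega : n = 0 ∨ n = -1) with h6 | h6
    · have h7 : D.coroot γ (D.act b p) = 0 := by
        rw [e, h6] at hn; push_cast at hn; linarith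
      rw [h7, zero_smul, sub_zero] at h4
      rw [h4] at hb ⊢
      exact ih hb
    · have h7 : D.coroot γ (D.act b p) = 1 := by
        rw [e, h6] at hn; push_cast at hn; linarith
      have hst : D.Step (D.act (D.srefl γ * b) p) (D.act b p) := by
        refine ⟨γ, hγ, by rw [e, h7], ?_⟩
        rw [h4, h7]; module
      exact Relation.ReflTransGen.head hst (ih (pre_step hsl hb hst))

lemma reach_word (hsl : D.SimplyLaced) {p : D.V} (hp : D.IsDominant p) {u v : D.W}
    (hu : D.MR p u) (hv : D.MR p v) (hpre : D.Pre (D.act u p))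
    (h : D.Reach (D.act u p) (D.act v p)) :
    D.bruhatLE v u ∧ ∃ l, D.Chn (D.act v p) l ∧ u = D.wordProd l * v := by
  obtain ⟨l, h1, h2⟩ := sreach_chn (reach_sreach hsl hpre h)
  obtain ⟨h3, h4⟩ := mr_chn hsl hp hv l h1
  have h5 := mr_unique hsl hp hu h3 (by rw [act_mul, h2])
  exact ⟨by rw [h5]; exact h4, l, h1, h5⟩

lemma arrow_iff (hsl : D.SimplyLaced) {p : D.V} (hp : D.IsDominant p) {u w : D.W} {β : D.V}
    (hw : D.MR p w) (hpre : D.Pre (D.act w p)) :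
    D.Arrow (D.stab p) u w β ↔ D.MR p u ∧ D.PP β ∧ D.coroot β (D.act w p) = -1 ∧
      D.act u p = D.act w p + β := by
  constructor
  · rintro ⟨hβ, hu, -, hco, hlt⟩
    have hu' := mr_of_minRep hsl hu
    have hco' : D.act (D.srefl β * w) p = D.act u p := coset_iff.mp hco
    have hr := bruhat_reach hsl hp hlt.1 hpre
    have hne : D.act w p ≠ D.act u p := fun h => hlt.2 (mr_unique hsl hp hu' hw h.symm)
    obtain ⟨γ, k, hγ, hk, e⟩ := root_mult hβ
    have hβm := hβ.1
    have hcor : D.coroot β (D.act w p) = k⁻¹ * D.coroot γ (D.act w p) := by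
      rw [e]; rw [e] at hβm
      exact D.coroot_smul hγ.mem hβm _
    have hs : D.srefl β = D.srefl γ := by
      rw [e]; rw [e] at hβm
      exact D.srefl_smul hγ.mem hβm
    obtain ⟨n, hn, hn1⟩ := hpre γ hγ
    have h1 : D.act u p = D.act w p - (n : ℚ) • γ := by
      rw [← hco', hs, act_mul, D.srefl_apply _ hγ.mem, hn]
    have h2 := (reach_hgt hr).resolve_left hne
    rw [h1, map_sub, map_smul, smul_eq_mul] at h2
    have h3 := hγ.one_le_hgt
    have h4 : n < 0 := by
      by_contra hc
      have : (0 : ℚ) ≤ n := by exact_mod_cast (not_lt.mp hc)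
      nlinarith
    have h5 : n = -1 := by omega
    subst h5
    have h6 : ∃ m : ℤ, D.coroot β (D.act w p) = m := by
      rw [D.coroot_act _ hβm]
      exact dom_int hp (D.roots_invariant _ _ hβm)
    obtain ⟨m, hm⟩ := h6
    have hk1 : k = 1 := by
      rw [hm, hn] at hcor
      push_cast at hcor
      have hk0 : k ≠ 0 := by linarith
      have h7 : k * m = -1 := by rw [hcor]; field_simp
      have h8 : m < 0 := by
        by_contra hc
        have : (0 : ℚ) ≤ m := by exact_mod_cast (not_lt.mp hc)
        nlinarith
      have h9 : (m : ℚ) ≤ -1 := by exact_mod_cast (by omega : m ≤ -1)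
      nlinarith
    rw [hk1, one_smul] at e
    subst e
    refine ⟨hu', hγ, by rw [hn]; norm_num, ?_⟩
    rw [h1]; push_cast; module
  · rintro ⟨hu, hβ, h1, h2⟩
    have hst : D.Step (D.act w p) (D.act u p) := ⟨β, hβ, h1, h2⟩
    refine ⟨hβ.isPos, minRep_of_mr hsl hp hu, minRep_of_mr hsl hp hw, ?_, ?_, ?_⟩
    · refine coset_iff.mpr ?_
      rw [act_mul, D.srefl_apply _ hβ.mem, h1, h2]; module
    · exact (reach_word hsl hp hw hu hpre (Relation.ReflTransGen.single hst)).1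
    · rintro rfl
      have := hβ.one_le_hgt
      have h3 := congrArg D.hgt h2
      rw [map_add] at h3
      linarith

variable (D) in
/-- paths of weights -/
def WPath : D.V → List D.V → Prop
  | _, [] => True
  | a, β :: t => D.PP β ∧ D.coroot β a = -1 ∧ WPath (a + β) t

lemma wpath_reach {a : D.V} {l : List D.V} (h : D.WPath a l) : D.Reach a (a + l.sum) := by
  induction l generalizing a with
  | nil => simp only [List.sum_nil, add_zero]; exact Relation.ReflTransGen.refl
  | cons β t ih =>
    refine Relation.ReflTransGen.head ⟨β, h.1, h.2.1, rfl⟩ ?_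
    have := ih h.2.2
    rw [List.sum_cons, ← add_assoc]; exact this

lemma arrowPath_iff (hsl : D.SimplyLaced) {p : D.V} (hp : D.IsDominant p) {v : D.W}
    (hv : D.MR p v) (l : List D.V) {w : D.W} (hw : D.MR p w) (hpre : D.Pre (D.act w p))
    (hr : D.Reach (D.act w p) (D.act v p)) :
    D.ArrowPathGE (D.stab p) v w l ↔
      D.WPath (D.act w p) l ∧ D.Reach (D.act w p + l.sum) (D.act v p) := by
  induction l generalizing w with
  | nil => simp [ArrowPathGE, WPath, hr]
  | cons β t ih =>
    constructor
    · rintro ⟨u, h1, h2, h3⟩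
      rw [arrow_iff hsl hp hw hpre] at h1
      obtain ⟨hu, hβ, h4, h5⟩ := h1
      have hpu := pre_step hsl hpre ⟨β, hβ, h4, h5⟩
      have := (ih hu hpu (bruhat_reach hsl hp h2 hpu)).mp h3
      rw [h5] at this
      rw [List.sum_cons, ← add_assoc]
      exact ⟨⟨hβ, h4, this.1⟩, this.2⟩
    · rintro ⟨⟨hβ, h4, h5⟩, h6⟩
      obtain ⟨u, hu, hu1, -⟩ := exists_mr hsl p (D.srefl β * w)
      have hu2 : D.act u p = D.act w p + β := by
        rw [hu1, act_mul, D.srefl_apply _ hβ.mem, h4]; module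
      have hpu := pre_step hsl hpre ⟨β, hβ, h4, hu2⟩
      rw [List.sum_cons, ← add_assoc] at h6
      rw [← hu2] at h5 h6
      have hru : D.Reach (D.act u p) (D.act v p) := (wpath_reach h5).trans h6
      exact ⟨u, (arrow_iff hsl hp hw hpre).mpr ⟨hu, hβ, h4, hu2⟩,
        (reach_word hsl hp hu hv hpu hru).1, (ih hu hpu hru).mpr ⟨h5, h6⟩⟩

lemma arrowPath_len {H : Subgroup D.W} {v : D.W} (l : List D.V) {w : D.W}
    (h : D.ArrowPathGE H v w l) : l.length ≤ D.length w ∧ ∀ β ∈ l, β ∈ D.roots := by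
  induction l generalizing w with
  | nil => simp
  | cons β t ih =>
    obtain ⟨u, h1, -, h3⟩ := h
    obtain ⟨h4, h5⟩ := ih h3
    have h6 := (bruhat_len h1.2.2.2.2.1).resolve_left h1.2.2.2.2.2
    refine ⟨by simp; omega, ?_⟩
    intro γ hγ
    rcases List.mem_cons.mp hγ with rfl | hγ
    · exact h1.1.1
    · exact h5 γ hγ

variable (D) in
/-- the skew set of roots in terms of weights -/
noncomputable def Sw (μ a : D.V) : Finset D.V :=
  D.roots.filter fun β => D.PP β ∧ D.coroot β a = -1 ∧ D.Reach (a + β) μ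

lemma sset_eq (hsl : D.SimplyLaced) {p : D.V} (hp : D.IsDominant p) {v w : D.W}
    (hv : D.MR p v) (hw : D.MR p w) (hpre : D.Pre (D.act w p)) :
    D.SsetSkew v w = D.Sw (D.act v p) (D.act w p) := by
  unfold SsetSkew Sw
  refine Finset.filter_congr fun β hβm => ?_
  constructor
  · rintro ⟨hβ, h1, h2⟩
    have hr := bruhat_reach hsl hp h2.1 hpre
    have hlen := (bruhat_len h2.1).resolve_left h2.2
    have hne : D.act w p ≠ D.act (D.srefl β * w) p := by
      intro h
      have := minRep_of_mr hsl hp hw (D.srefl β * w) (coset_iff.mpr h)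
      omega
    obtain ⟨u, hu, hu1, hu2⟩ := exists_mr hsl p (D.srefl β * w)
    have har : D.Arrow (D.stab p) u w β := by
      refine ⟨hβ, minRep_of_mr hsl hp hu, minRep_of_mr hsl hp hw, coset_iff.mpr hu1.symm,
        hu2.trans h2.1, ?_⟩
      rintro rfl
      exact hne hu1
    rw [arrow_iff hsl hp hw hpre] at har
    obtain ⟨-, h3, h4, h5⟩ := har
    refine ⟨h3, h4, ?_⟩
    have hpu := pre_step hsl hpre ⟨β, h3, h4, h5⟩
    have := bruhat_reach hsl hp h1 (by rw [← hu1]; exact hpu)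
    rwa [← hu1, h5] at this
  · rintro ⟨hβ, h1, h2⟩
    obtain ⟨u, hu, hu1, hu2⟩ := exists_mr hsl p (D.srefl β * w)
    have hu3 : D.act u p = D.act w p + β := by
      rw [hu1, act_mul, D.srefl_apply _ hβ.mem, h1]; module
    have hpu := pre_step hsl hpre ⟨β, hβ, h1, hu3⟩
    rw [← hu3] at h2
    have hlen : D.length (D.srefl β * w) < D.length w := by
      apply len_lt_left hsl hβ
      rcases (hβ.1.act w⁻¹).pos_or with h | h
      · exfalso
        have := dom_nonneg hsl hp h
        rw [← D.coroot_act _ hβ.mem, h1] at this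
        norm_num at this
      · exact h
    refine ⟨hβ.isPos, (reach_word hsl hp hu hv hpu h2).1.trans hu2, ?_, ?_⟩
    · refine Relation.ReflTransGen.single ⟨⟨β, hβ.isPos, ?_⟩, hlen⟩
      rw [← mul_assoc, D.srefl_sq hβ.mem, one_mul]
    · intro h
      rw [h] at hlen
      exact lt_irrefl _ hlen

end helper2
end WeylSetting

namespace WeylSetting

variable {D : WeylSetting}

/-! ### Sums over paths -/

lemma wpath_append {a : D.V} (l : List D.V) (β : D.V) :
    D.WPath a (l ++ [β]) ↔ D.WPath a l ∧ D.PP β ∧ D.coroot β (a + l.sum) = -1 := by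
  induction l generalizing a with
  | nil => simp [WPath]
  | cons γ t ih =>
    simp only [List.cons_append, WPath, ih, List.sum_cons, add_assoc, and_assoc]

variable (D) in
/-- the finite set of weight paths (junk if infinite) -/
noncomputable def PF (a : D.V) : Finset (List D.V) :=
  if h : {l | D.WPath a l}.Finite then h.toFinset else ∅

lemma mem_PF {a : D.V} (h : {l | D.WPath a l}.Finite) {l : List D.V} :
    l ∈ D.PF a ↔ D.WPath a l := by
  unfold PF
  rw [dif_pos h]
  simp

lemma pathTerm_nil {F : Type} [Field F] [Algebra ℚ F] (emb : D.V →ₗ[ℚ] F) :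
    D.pathTerm emb [] = 1 := by simp [pathTerm]

lemma pathTerm_snoc {F : Type} [Field F] [Algebra ℚ F] (emb : D.V →ₗ[ℚ] F) (l : List D.V)
    (β : D.V) : D.pathTerm emb (l ++ [β]) = D.pathTerm emb l * (emb (l.sum + β))⁻¹ := by
  unfold pathTerm
  rw [List.length_append, List.length_singleton, Finset.prod_range_succ]
  congr 1
  · refine Finset.prod_congr rfl fun j hj => ?_
    rw [Finset.mem_range] at hj
    rw [List.take_append_of_le_length (by omega)]
  · rw [List.take_of_length_le (by simp)]
    simp

/-- sum of the path terms with given end -/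
noncomputable def Psi {F : Type} [Field F] [Algebra ℚ F] (emb : D.V →ₗ[ℚ] F) (a k : D.V) : F :=
  ∑ l ∈ (D.PF a).filter (fun l => a + l.sum = k), D.pathTerm emb l

variable {F : Type} [Field F] [Algebra ℚ F]

lemma psi_zero (emb : D.V →ₗ[ℚ] F) {a k : D.V} (hf : {l | D.WPath a l}.Finite)
    (h : ¬ D.Reach a k) : Psi emb a k = 0 := by
  unfold Psi
  apply Finset.sum_eq_zero
  intro l hl
  rw [Finset.mem_filter, mem_PF hf] at hl
  exact (h (hl.2 ▸ wpath_reach hl.1)).elim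

lemma wpath_sum_zero {a : D.V} {l : List D.V} (h : D.WPath a l) (h0 : a + l.sum = a) : l = [] := by
  cases l with
  | nil => rfl
  | cons β t =>
    exfalso
    obtain ⟨h1, h2, h3⟩ := h
    have h4 := reach_hgt (wpath_reach h3)
    have h5 : a + β + t.sum = a := by rw [← h0]; simp [add_assoc] at *; simpa using h0
    rw [h5] at h4
    have := h1.one_le_hgt
    rcases h4 with h4 | h4
    · have := congrArg D.hgt h4
      rw [map_add] at this
      linarith
    · rw [map_add] at h4
      linarith

lemma psi_self (emb : D.V →ₗ[ℚ] F) {a : D.V} (hf : {l | D.WPath a l}.Finite) :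
    Psi emb a a = 1 := by
  unfold Psi
  have : (D.PF a).filter (fun l => a + l.sum = a) = {[]} := by
    ext l
    rw [Finset.mem_filter, mem_PF hf, Finset.mem_singleton]
    constructor
    · rintro ⟨h, h0⟩; exact wpath_sum_zero h h0
    · rintro rfl; exact ⟨trivial, by simp⟩
  rw [this, Finset.sum_singleton, pathTerm_nil]

lemma reach_antisymm_hgt {a b : D.V} (h : D.Reach a b) (h' : D.hgt b ≤ D.hgt a) : a = b := by
  rcases reach_hgt h with h | h
  · exact h
  · linarith

lemma psi_rec (emb : D.V →ₗ[ℚ] F) (he : Function.Injective emb) {a : D.V}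
    (hf : {l | D.WPath a l}.Finite) (k : D.V) :
    emb (k - a) * Psi emb a k =
      ∑ β ∈ D.roots.filter (fun β => D.PP β), if D.coroot β k = 1 then Psi emb a (k - β) else 0 := by
  by_cases hk : k = a
  · subst hk
    rw [sub_self, map_zero, zero_mul]
    symm
    apply Finset.sum_eq_zero
    intro β hβ
    rw [Finset.mem_filter] at hβ
    split_ifs
    · apply psi_zero emb hf
      intro h
      have h1 := hβ.2.one_le_hgt
      have h2 := reach_hgt h
      rw [map_sub] at h2
      rcases h2 with h2 | h2
      · have := congrArg D.hgt h2
        rw [map_sub] at this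
        linarith
      · linarith
    · rfl
  · have hne : emb (k - a) ≠ 0 := by
      rw [← map_zero emb]
      exact fun h => hk (sub_eq_zero.mp (he h))
    unfold Psi
    rw [← Finset.sum_filter, Finset.mul_sum, Finset.sum_sigma']
    symm
    refine Finset.sum_bij (fun p _ => p.2 ++ [p.1]) ?_ ?_ ?_ ?_
    · rintro ⟨β, l⟩ h
      simp only [Finset.mem_sigma, Finset.mem_filter, mem_PF hf] at h ⊢
      obtain ⟨⟨⟨h1, h2⟩, h3⟩, h4, h5⟩ := h
      refine ⟨(wpath_append l β).mpr ⟨h4, h2, ?_⟩, ?_⟩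
      · rw [h5, map_sub, h3, D.coroot_self _ h1]; norm_num
      · rw [List.sum_append, List.sum_singleton, ← add_assoc, h5]; abel
    · rintro ⟨β, l⟩ _ ⟨β', l'⟩ _ h
      simp only at h
      obtain ⟨h1, h2⟩ := List.append_inj' h rfl
      simp only [List.cons.injEq, and_true] at h2
      rw [h1, h2]
    · intro l hl
      rw [Finset.mem_filter, mem_PF hf] at hl
      rcases List.eq_nil_or_concat l with rfl | ⟨t, β, rfl⟩
      · exact (hk (by simpa using hl.2.symm)).elim
      · rw [List.concat_eq_append] at *
        obtain ⟨h1, h2⟩ := hl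
        obtain ⟨h3, h4, h5⟩ := (wpath_append t β).mp h1
        rw [List.sum_append, List.sum_singleton, ← add_assoc] at h2
        refine ⟨⟨β, t⟩, ?_, rfl⟩
        simp only [Finset.mem_sigma, Finset.mem_filter, mem_PF hf]
        refine ⟨⟨⟨h4.mem, h4⟩, ?_⟩, h3, ?_⟩
        · rw [← h2, map_add, h5, D.coroot_self _ h4.mem]; norm_num
        · rw [← h2]; abel
    · rintro ⟨β, l⟩ h
      simp only [Finset.mem_sigma, Finset.mem_filter, mem_PF hf] at h ⊢
      obtain ⟨⟨⟨h1, h2⟩, h3⟩, h4, h5⟩ := h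
      rw [pathTerm_snoc]
      have : l.sum + β = k - a := by
        have : l.sum = k - β - a := by rw [← h5]; abel
        rw [this]; abel
      rw [this]
      field_simp

/-- splitting off a simple root -/
lemma sum_split (i : D.I) (f : D.V → F) :
    ∑ β ∈ D.roots.filter (fun β => D.PP β), f β =
      (∑ β ∈ D.roots.filter (fun β => D.PP β ∧ β ≠ D.simple i), f β) + f (D.simple i) := by
  have h : D.roots.filter (fun β => D.PP β) =
      insert (D.simple i) (D.roots.filter (fun β => D.PP β ∧ β ≠ D.simple i)) := by
    ext β
    simp only [Finset.mem_filter, Finset.mem_insert]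
    constructor
    · rintro ⟨h1, h2⟩
      by_cases h3 : β = D.simple i
      · exact Or.inl h3
      · exact Or.inr ⟨h1, h2, h3⟩
    · rintro (rfl | ⟨h1, h2, -⟩)
      · exact ⟨D.simple_mem i, D.pp_simple i⟩
      · exact ⟨h1, h2⟩
  rw [h, Finset.sum_insert (by simp), add_comm]

lemma s_simple (i : D.I) : D.act (D.s i) (D.simple i) = - D.simple i :=
  D.srefl_self (D.simple_mem i)

lemma s_ne_simple {β : D.V} (hβ : D.PP β) (i : D.I) : D.act (D.s i) β ≠ D.simple i := by
  intro h
  have : β = - D.simple i := by rw [← s_simple, ← h, s_s_apply]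
  exact hβ.not_neg (by rw [this, neg_neg]; exact D.pp_simple i)

lemma sum_refl (hsl : D.SimplyLaced) (i : D.I) (f : D.V → F) :
    ∑ β ∈ D.roots.filter (fun β => D.PP β ∧ β ≠ D.simple i), f (D.act (D.s i) β) =
      ∑ β ∈ D.roots.filter (fun β => D.PP β ∧ β ≠ D.simple i), f β := by
  have hm : ∀ β ∈ D.roots.filter (fun β => D.PP β ∧ β ≠ D.simple i),
      D.act (D.s i) β ∈ D.roots.filter (fun β => D.PP β ∧ β ≠ D.simple i) := by
    intro β hβ
    rw [Finset.mem_filter] at hβ ⊢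
    exact ⟨D.roots_invariant _ _ hβ.1, pp_s hsl hβ.2.1 i hβ.2.2, s_ne_simple hβ.2.1 i⟩
  exact Finset.sum_nbij' (fun β => D.act (D.s i) β) (fun β => D.act (D.s i) β) hm hm
    (fun β _ => s_s_apply i β) (fun β _ => s_s_apply i β) (fun β _ => rfl)

/-! ### Stability of intervals -/

lemma step_s (hsl : D.SimplyLaced) (i : D.I) {a β : D.V} (hβ : D.PP β) (hn : β ≠ D.simple i)
    (h : D.coroot β a = -1) : D.Step (D.act (D.s i) a) (D.act (D.s i) (a + β)) := by
  refine ⟨D.act (D.s i) β, pp_s hsl hβ i hn, ?_, map_add _ _ _⟩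
  rw [coroot_s i (D.roots_invariant _ _ hβ.mem), s_s_apply, h]

lemma s_of_neg (i : D.I) {a : D.V} (h : D.coroot (D.simple i) a = -1) :
    D.act (D.s i) a = a + D.simple i := by
  rw [s_apply, h]; module

lemma s_of_pos (i : D.I) {a : D.V} (h : D.coroot (D.simple i) a = 1) :
    D.act (D.s i) a = a - D.simple i := by
  rw [s_apply, h]; module

lemma reach_s (hsl : D.SimplyLaced) (i : D.I) {a b : D.V}
    (ha : D.coroot (D.simple i) a = -1) (h : D.Reach a b) : D.Reach a (D.act (D.s i) b) := by
  induction h with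
  | refl => 
    exact Relation.ReflTransGen.single ⟨_, D.pp_simple i, ha, s_of_neg i ha⟩
  | @tail b c h1 h2 ih =>
    obtain ⟨β, hβ, h3, rfl⟩ := h2
    by_cases hn : β = D.simple i
    · subst hn
      rw [← s_of_neg i h3, s_s_apply]
      exact h1
    · exact ih.tail (step_s hsl i hβ hn h3)

lemma coroot_simple_s (i : D.I) (x : D.V) :
    D.coroot (D.simple i) (D.act (D.s i) x) = - D.coroot (D.simple i) x := by
  rw [coroot_s i (D.simple_mem i), s_simple, D.coroot_neg (D.simple_mem i)]

lemma pair_small {b : D.V} (i : D.I) (h1 : D.Pre b) (h2 : D.Pre (D.act (D.s i) b)) :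
    D.coroot (D.simple i) b = -1 ∨ D.coroot (D.simple i) b = 0 ∨ D.coroot (D.simple i) b = 1 := by
  obtain ⟨n, hn, hn1⟩ := h1 _ (D.pp_simple i)
  obtain ⟨m, hm, hm1⟩ := h2 _ (D.pp_simple i)
  rw [coroot_simple_s, hn] at hm
  have : -n = m := by exact_mod_cast hm
  rw [hn]
  rcases (by omega : n = -1 ∨ n = 0 ∨ n = 1) with h | h | h
  · left; rw [h]; norm_num
  · right; left; rw [h]; norm_num
  · right; right; rw [h]; norm_num

lemma reach_s_end (hsl : D.SimplyLaced) (i : D.I) {a b m : D.V} (hpre : D.Pre a)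
    (ha : D.coroot (D.simple i) a = -1) (hm : 0 ≤ D.coroot (D.simple i) m)
    (hab : D.Reach a b) (h : D.Reach b m) : D.Reach (D.act (D.s i) b) m := by
  revert hab
  induction h using Relation.ReflTransGen.head_induction_on with
  | refl =>
    intro hab
    rcases pair_small i (pre_reach hsl hpre hab) (pre_reach hsl hpre (reach_s hsl i ha hab))
      with h | h | h
    · rw [h] at hm; norm_num at hm
    · rw [s_apply, h, zero_smul, sub_zero]; exact Relation.ReflTransGen.refl
    · refine Relation.ReflTransGen.single ⟨_, D.pp_simple i, ?_, ?_⟩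
      · rw [coroot_simple_s, h]
      · rw [s_of_pos i h]; abel
  | @head b c h1 h2 ih =>
    intro hab
    have hac := hab.tail h1
    obtain ⟨β, hβ, h3, rfl⟩ := h1
    by_cases hn : β = D.simple i
    · subst hn
      rw [s_of_neg i h3]
      exact h2
    · exact Relation.ReflTransGen.head (step_s hsl i hβ hn h3) (ih hac)

lemma finite_s (i : D.I) {a : D.V} (ha : D.coroot (D.simple i) a = -1)
    (hf : {l | D.WPath a l}.Finite) : {l | D.WPath (D.act (D.s i) a) l}.Finite := by
  have h := hf.preimage (f := fun l => D.simple i :: l) (by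
    intro x _ y _ h
    simpa using h)
  refine h.subset fun l hl => ?_
  exact ⟨D.pp_simple i, ha, by rw [← s_of_neg i ha]; exact hl⟩

/-- the embedding twisted by a simple reflection -/
noncomputable def tw (emb : D.V →ₗ[ℚ] F) (i : D.I) : D.V →ₗ[ℚ] F :=
  emb.comp (D.act (D.s i)).toLinearMap

lemma tw_apply (emb : D.V →ₗ[ℚ] F) (i : D.I) (x : D.V) : tw emb i x = emb (D.act (D.s i) x) := rfl

lemma tw_inj {emb : D.V →ₗ[ℚ] F} (he : Function.Injective emb) (i : D.I) :
    Function.Injective (tw emb i) := by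
  intro x y h
  exact (D.act (D.s i)).injective (he h)

lemma psi_key (hsl : D.SimplyLaced) (emb : D.V →ₗ[ℚ] F) (he : Function.Injective emb) (i : D.I)
    {a : D.V} (hpre : D.Pre a) (ha : D.coroot (D.simple i) a = -1)
    (hf : {l | D.WPath a l}.Finite) (k : D.V) :
    Psi emb a k = Psi (tw emb i) (D.act (D.s i) a) (D.act (D.s i) k) +
      (emb (D.simple i))⁻¹ * Psi (tw emb i) (D.act (D.s i) a) k := by
  have hf' := finite_s i ha hf
  have hsub : D.Step a (D.act (D.s i) a) := ⟨_, D.pp_simple i, ha, s_of_neg i ha⟩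
  have hα : emb (D.simple i) ≠ 0 := by
    rw [← map_zero emb]
    exact fun h => D.root_ne_zero (D.simple_mem i) (he h)
  have key : ∀ n : ℕ, ∀ k, D.hgt (k - a) < n →
      Psi emb a k = Psi (tw emb i) (D.act (D.s i) a) (D.act (D.s i) k) +
      (emb (D.simple i))⁻¹ * Psi (tw emb i) (D.act (D.s i) a) k := by
    intro n
    induction n with
    | zero =>
      intro k hk
      have hr : ¬ D.Reach a k := by
        intro h
        rw [map_sub] at hk
        push_cast at hk
        rcases reach_hgt h with h | h
        · rw [h] at hk; linarith
        · linarith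
      rw [psi_zero emb hf hr, psi_zero _ hf', psi_zero _ hf', mul_zero, add_zero]
      · exact fun h => hr (Relation.ReflTransGen.head hsub h)
      · intro h
        have := reach_s hsl i ha (Relation.ReflTransGen.head hsub h)
        rw [s_s_apply] at this
        exact hr this
    | succ n ih =>
      intro k hk
      by_cases hr : D.Reach a k
      swap
      · rw [psi_zero emb hf hr, psi_zero _ hf', psi_zero _ hf', mul_zero, add_zero]
        · exact fun h => hr (Relation.ReflTransGen.head hsub h)
        · intro h
          have := reach_s hsl i ha (Relation.ReflTransGen.head hsub h)
          rw [s_s_apply] at this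
          exact hr this
      by_cases hka : k = a
      · subst hka
        rw [psi_self emb hf, psi_self _ hf', psi_zero _ hf', mul_zero, add_zero]
        intro h
        have := reach_antisymm_hgt h (by rw [s_of_neg i ha, map_add, hgt_simple]; linarith)
        rw [s_of_neg i ha] at this
        exact D.root_ne_zero (D.simple_mem i) (by simpa using this)
      have hne : emb (k - a) ≠ 0 := by
        rw [← map_zero emb]
        exact fun h => hka (sub_eq_zero.mp (he h))
      have hsm := pair_small i (pre_reach hsl hpre hr) (pre_reach hsl hpre (reach_s hsl i ha hr))
      set B := Psi (tw emb i) (D.act (D.s i) a) with hB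
      have hih : ∀ β, D.PP β → Psi emb a (k - β) = B (D.act (D.s i) (k - β)) +
          (emb (D.simple i))⁻¹ * B (k - β) := by
        intro β hβ
        apply ih
        have := hβ.one_le_hgt
        have e : k - β - a = (k - a) - β := by abel
        rw [e, map_sub]
        push_cast at hk
        linarith
      set Q := D.roots.filter (fun β => D.PP β ∧ β ≠ D.simple i) with hQ
      -- recursion for the left-hand side
      have e1 := psi_rec emb he hf k
      rw [sum_split i] at e1
      have e1' : ∑ β ∈ Q, (if D.coroot β k = 1 then Psi emb a (k - β) else 0) =
          ∑ β ∈ Q, (if D.coroot β k = 1 then B (D.act (D.s i) (k - β)) else 0) +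
          (emb (D.simple i))⁻¹ * ∑ β ∈ Q, (if D.coroot β k = 1 then B (k - β) else 0) := by
        rw [Finset.mul_sum, ← Finset.sum_add_distrib]
        refine Finset.sum_congr rfl fun β hβ => ?_
        rw [hQ, Finset.mem_filter] at hβ
        split_ifs
        · exact hih β hβ.2.1
        · simp
      rw [e1'] at e1
      -- recursion at the reflected end
      have e2 := psi_rec (tw emb i) (tw_inj he i) hf' (D.act (D.s i) k)
      rw [sum_split i, ← sum_refl hsl, tw_apply, map_sub, s_s_apply, s_s_apply, ← hB] at e2
      have e2' : ∑ β ∈ Q, (if D.coroot (D.act (D.s i) β) (D.act (D.s i) k) = 1 then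
            B (D.act (D.s i) k - D.act (D.s i) β) else 0) =
          ∑ β ∈ Q, (if D.coroot β k = 1 then B (D.act (D.s i) (k - β)) else 0) := by
        refine Finset.sum_congr rfl fun β hβ => ?_
        rw [hQ, Finset.mem_filter] at hβ
        rw [D.coroot_equivariant _ _ hβ.1, map_sub]
      rw [e2'] at e2
      -- recursion at the end itself
      have e3 := psi_rec (tw emb i) (tw_inj he i) hf' k
      rw [sum_split i, tw_apply, map_sub, s_s_apply, ← hB] at e3
      rw [coroot_simple_s] at e2
      apply mul_left_cancel₀ hne
      rw [e1, mul_add, e2]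
      set S1 := ∑ β ∈ Q, (if D.coroot β k = 1 then B (D.act (D.s i) (k - β)) else 0)
      set S2 := ∑ β ∈ Q, (if D.coroot β k = 1 then B (k - β) else 0)
      rcases hsm with hm | hm | hm
      · rw [hm] at e3 ⊢
        rw [s_of_neg i hm] at e3 ⊢
        have e4 : k + D.simple i - a = (k - a) + D.simple i := by abel
        rw [e4, map_add, if_neg (by norm_num), add_zero] at e3
        rw [if_neg (by norm_num), if_pos (by norm_num), add_sub_cancel_right, ← e3]
        field_simp
        ring
      · rw [hm] at e3 ⊢
        rw [s_apply, hm, zero_smul, sub_zero, if_neg (by norm_num), add_zero] at e3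
        rw [if_neg (by norm_num), if_neg (by norm_num), ← e3]
        ring
      · rw [hih _ (D.pp_simple i)]
        rw [← s_of_pos i hm, s_s_apply]
        rw [hm] at e3 ⊢
        rw [← s_of_pos i hm] at e3
        nth_rewrite 1 [s_of_pos i hm] at e3
        have e4 : k - D.simple i - a = (k - a) - D.simple i := by abel
        rw [e4, map_sub, if_pos rfl] at e3
        rw [if_pos rfl, if_neg (by norm_num)]
        have e5 : S2 = (emb (k - a) - emb (D.simple i)) * B k - B (D.act (D.s i) k) := by
          rw [e3]; ring
        rw [e5]
        field_simp
        ring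
  obtain ⟨n, hn⟩ := exists_nat_gt (D.hgt (k - a))
  exact key n k hn

end WeylSetting

namespace WeylSetting

variable {D : WeylSetting} {F : Type} [Field F] [Algebra ℚ F]

lemma reach_wpath {a b : D.V} (h : D.Reach a b) : ∃ l, D.WPath a l ∧ a + l.sum = b := by
  induction h with
  | refl => exact ⟨[], trivial, by simp⟩
  | tail _ h2 ih =>
    obtain ⟨β, hβ, h3, rfl⟩ := h2
    obtain ⟨l, h4, h5⟩ := ih
    refine ⟨l ++ [β], (wpath_append l β).mpr ⟨h4, hβ, by rw [h5, h3]⟩, ?_⟩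
    rw [List.sum_append, List.sum_singleton, ← add_assoc, h5]

/-- the total sum over paths staying above a given weight -/
noncomputable def GG (emb : D.V →ₗ[ℚ] F) (m a : D.V) : F :=
  ∑ l ∈ (D.PF a).filter (fun l => D.Reach (a + l.sum) m), D.pathTerm emb l

lemma gg_eq (emb : D.V →ₗ[ℚ] F) {m a : D.V} (hf : {l | D.WPath a l}.Finite) (K : Finset D.V)
    (h1 : ∀ k, D.Reach a k → D.Reach k m → k ∈ K) (h2 : ∀ k ∈ K, D.Reach k m) :
    GG emb m a = ∑ k ∈ K, Psi emb a k := by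
  unfold GG Psi
  rw [← Finset.sum_fiberwise_of_maps_to (t := K) (g := fun l => a + l.sum)]
  · refine Finset.sum_congr rfl fun k hk => ?_
    refine Finset.sum_congr ?_ fun _ _ => rfl
    ext l
    simp only [Finset.mem_filter, and_assoc]
    constructor
    · rintro ⟨h3, -, h5⟩; exact ⟨h3, h5⟩
    · rintro ⟨h3, h5⟩; exact ⟨h3, h5 ▸ h2 k hk, h5⟩
  · intro l hl
    rw [Finset.mem_filter, mem_PF hf] at hl
    exact h1 _ (wpath_reach hl.1) hl.2

lemma gg_step (hsl : D.SimplyLaced) (emb : D.V →ₗ[ℚ] F) (he : Function.Injective emb) (i : D.I)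
    {m a : D.V} (hpre : D.Pre a) (ha : D.coroot (D.simple i) a = -1)
    (hf : {l | D.WPath a l}.Finite) (hm : 0 ≤ D.coroot (D.simple i) m) :
    GG emb m a = (1 + (emb (D.simple i))⁻¹) * GG (tw emb i) m (D.act (D.s i) a) := by
  have hf' := finite_s i ha hf
  have hsub : D.Step a (D.act (D.s i) a) := ⟨_, D.pp_simple i, ha, s_of_neg i ha⟩
  set K : Finset D.V := ((D.PF a).image (fun l => a + l.sum)).filter (fun k => D.Reach k m) with hK
  have memK : ∀ k, k ∈ K ↔ D.Reach a k ∧ D.Reach k m := by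
    intro k
    rw [hK, Finset.mem_filter, Finset.mem_image]
    refine and_congr_left fun _ => ⟨?_, fun h => ?_⟩
    · rintro ⟨l, hl, rfl⟩
      exact wpath_reach ((mem_PF hf).mp hl)
    · obtain ⟨l, h1, h2⟩ := reach_wpath h
      exact ⟨l, (mem_PF hf).mpr h1, h2⟩
  have hst : ∀ k ∈ K, D.act (D.s i) k ∈ K := by
    intro k hk
    rw [memK] at hk ⊢
    exact ⟨reach_s hsl i ha hk.1, reach_s_end hsl i hpre ha hm hk.1 hk.2⟩
  rw [gg_eq emb hf K (fun k h1 h2 => (memK k).mpr ⟨h1, h2⟩) (fun k hk => ((memK k).mp hk).2),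
    gg_eq (tw emb i) hf' K (fun k h1 h2 => (memK k).mpr ⟨Relation.ReflTransGen.head hsub h1, h2⟩)
      (fun k hk => ((memK k).mp hk).2)]
  have e : ∑ k ∈ K, Psi (tw emb i) (D.act (D.s i) a) (D.act (D.s i) k) =
      ∑ k ∈ K, Psi (tw emb i) (D.act (D.s i) a) k :=
    Finset.sum_nbij' (fun k => D.act (D.s i) k) (fun k => D.act (D.s i) k) hst hst
      (fun k _ => s_s_apply i k) (fun k _ => s_s_apply i k) (fun k _ => rfl)
  rw [Finset.sum_congr rfl fun k _ => psi_key hsl emb he i hpre ha hf k,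
    Finset.sum_add_distrib, e, ← Finset.mul_sum]
  ring

lemma sw_step (hsl : D.SimplyLaced) (i : D.I) {m a : D.V} (hpre : D.Pre a)
    (ha : D.coroot (D.simple i) a = -1) (hm : 0 ≤ D.coroot (D.simple i) m)
    (hr : D.Reach (D.act (D.s i) a) m) (f : D.V → F) :
    ∏ β ∈ D.Sw m a, f β = f (D.simple i) * ∏ β ∈ D.Sw m (D.act (D.s i) a), f (D.act (D.s i) β) := by
  have hsub : D.Step a (D.act (D.s i) a) := ⟨_, D.pp_simple i, ha, s_of_neg i ha⟩
  have e : D.Sw m a = insert (D.simple i)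
      ((D.Sw m (D.act (D.s i) a)).image (fun β => D.act (D.s i) β)) := by
    ext β
    simp only [Sw, Finset.mem_insert, Finset.mem_image, Finset.mem_filter]
    constructor
    · rintro ⟨h1, h2, h3, h4⟩
      by_cases hn : β = D.simple i
      · exact Or.inl hn
      · right
        refine ⟨D.act (D.s i) β, ⟨D.roots_invariant _ _ h1, pp_s hsl h2 i hn, ?_, ?_⟩,
          s_s_apply i β⟩
        · rw [D.coroot_equivariant _ _ h1, h3]
        · rw [← map_add]
          exact reach_s_end hsl i hpre ha hm
            (Relation.ReflTransGen.single ⟨β, h2, h3, rfl⟩) h4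
    · rintro (rfl | ⟨γ, ⟨h1, h2, h3, h4⟩, rfl⟩)
      · exact ⟨D.simple_mem i, D.pp_simple i, ha, by rw [← s_of_neg i ha]; exact hr⟩
      · have hn : γ ≠ D.simple i := by
          rintro rfl
          rw [coroot_simple_s, ha] at h3
          norm_num at h3
        refine ⟨D.roots_invariant _ _ h1, pp_s hsl h2 i hn, ?_, ?_⟩
        · rw [← coroot_s i h1, h3]
        · have := reach_s_end hsl i hpre ha hm
            ((Relation.ReflTransGen.single hsub).tail ⟨γ, h2, h3, rfl⟩) h4
          rwa [map_add, s_s_apply] at this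
  rw [e, Finset.prod_insert, Finset.prod_image]
  · intro x _ y _ h
    exact (D.act (D.s i)).injective h
  · rw [Finset.mem_image]
    rintro ⟨γ, hγ, h⟩
    unfold Sw at hγ
    rw [Finset.mem_filter] at hγ
    exact s_ne_simple hγ.2.1 i h

lemma chn_reach {m : D.V} (l : List D.I) (h : D.Chn m l) : D.Reach (D.act (D.wordProd l) m) m := by
  induction l with
  | nil => rw [wordProd_nil, act_one]; exact Relation.ReflTransGen.refl
  | cons i t ih =>
    refine Relation.ReflTransGen.head ⟨_, D.pp_simple i, ?_, ?_⟩ (ih h.2)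
    · rw [wordProd_cons, act_mul, coroot_simple_s, h.1]
    · rw [wordProd_cons, act_mul, s_of_pos i h.1]; abel

lemma weight_formula (hsl : D.SimplyLaced) {m : D.V} (l : List D.I) (hl : D.Chn m l)
    (hnn : ∀ i ∈ l, 0 ≤ D.coroot (D.simple i) m) (emb : D.V →ₗ[ℚ] F)
    (he : Function.Injective emb) (hpre : D.Pre (D.act (D.wordProd l) m))
    (hf : {t | D.WPath (D.act (D.wordProd l) m) t}.Finite) :
    GG emb m (D.act (D.wordProd l) m) =
      ∏ β ∈ D.Sw m (D.act (D.wordProd l) m), (1 + (emb β)⁻¹) := by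
  induction l generalizing emb with
  | nil =>
    rw [wordProd_nil, act_one] at *
    have h1 : (D.PF m).filter (fun l => D.Reach (m + l.sum) m) = {[]} := by
      ext l
      rw [Finset.mem_filter, mem_PF hf, Finset.mem_singleton]
      constructor
      · rintro ⟨h1, h2⟩
        apply wpath_sum_zero h1
        have h3 := wpath_reach h1
        rcases reach_hgt h3 with h | h
        · exact h.symm
        · exact reach_antisymm_hgt h2 (by linarith)
      · rintro rfl
        exact ⟨trivial, by simp only [List.sum_nil, add_zero]; exact Relation.ReflTransGen.refl⟩
    have h2 : D.Sw m m = ∅ := by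
      rw [Finset.eq_empty_iff_forall_notMem]
      intro β hβ
      unfold Sw at hβ
      rw [Finset.mem_filter] at hβ
      have h3 := hβ.2.1.one_le_hgt
      have h4 := reach_antisymm_hgt hβ.2.2.2 (by rw [map_add]; linarith)
      exact D.root_ne_zero hβ.1 (by simpa using h4)
    unfold GG
    rw [h1, h2, Finset.sum_singleton, pathTerm_nil, Finset.prod_empty]
  | cons i t ih =>
    have e : D.act (D.s i) (D.act (D.wordProd (i :: t)) m) = D.act (D.wordProd t) m := by
      rw [wordProd_cons, act_mul, s_s_apply]
    have ha : D.coroot (D.simple i) (D.act (D.wordProd (i :: t)) m) = -1 := by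
      rw [wordProd_cons, act_mul, coroot_simple_s, hl.1]
    set a := D.act (D.wordProd (i :: t)) m
    have hm := hnn i (by simp)
    have hr := chn_reach t hl.2
    have hf' := finite_s i ha hf
    have hpre' : D.Pre (D.act (D.s i) a) :=
      pre_step hsl hpre ⟨_, D.pp_simple i, ha, s_of_neg i ha⟩
    rw [gg_step hsl emb he i hpre ha hf hm, sw_step hsl i hpre ha hm (by rw [e]; exact hr)]
    congr 1
    rw [e] at hf' hpre' ⊢
    exact ih hl.2 (fun j hj => hnn j (by simp [hj])) (tw emb i) (tw_inj he i) hpre' hf'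

/-! ### Finiteness -/

lemma wpath_len (hsl : D.SimplyLaced) {p : D.V} (hp : D.IsDominant p) (l : List D.V) {w : D.W}
    (hw : D.MR p w) (hpre : D.Pre (D.act w p)) (h : D.WPath (D.act w p) l) :
    l.length ≤ D.length w ∧ ∀ β ∈ l, β ∈ D.roots := by
  induction l generalizing w with
  | nil => simp
  | cons β t ih =>
    obtain ⟨hβ, h4, h5⟩ := h
    obtain ⟨u, hu, hu1, -⟩ := exists_mr hsl p (D.srefl β * w)
    have hu2 : D.act u p = D.act w p + β := by
      rw [hu1, act_mul, D.srefl_apply _ hβ.mem, h4]; module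
    have hpu := pre_step hsl hpre ⟨β, hβ, h4, hu2⟩
    have har := (arrow_iff hsl hp hw hpre).mpr ⟨hu, hβ, h4, hu2⟩
    rw [← hu2] at h5
    obtain ⟨h6, h7⟩ := ih hu hpu h5
    have h8 := (bruhat_len har.2.2.2.2.1).resolve_left har.2.2.2.2.2
    refine ⟨by simp; omega, ?_⟩
    intro γ hγ
    rcases List.mem_cons.mp hγ with rfl | hγ
    · exact hβ.mem
    · exact h7 γ hγ

lemma finite_lists (S : Finset D.V) (n : ℕ) :
    {l : List D.V | l.length ≤ n ∧ ∀ β ∈ l, β ∈ S}.Finite := by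
  have h := List.finite_length_le {x // x ∈ S} n
  refine (h.image (List.map Subtype.val)).subset ?_
  rintro l ⟨h1, h2⟩
  refine ⟨l.attach.map (fun x => ⟨x.1, h2 _ x.2⟩), by simpa using h1, ?_⟩
  simp [List.map_map, Function.comp_def]

lemma wpath_finite (hsl : D.SimplyLaced) {p : D.V} (hp : D.IsDominant p) {w : D.W}
    (hw : D.MR p w) (hpre : D.Pre (D.act w p)) : {l | D.WPath (D.act w p) l}.Finite :=
  (finite_lists D.roots (D.length w)).subset fun l hl => wpath_len hsl hp l hw hpre hl

/-! ### The word of the second minuscule condition -/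

lemma wordProd_reverse_inv (l : List D.I) : D.wordProd l.reverse = (D.wordProd l)⁻¹ := by
  induction l with
  | nil => simp [wordProd_nil]
  | cons i t ih =>
    rw [List.reverse_cons, wordProd_append, ih, wordProd_cons, wordProd_cons, wordProd_nil,
      mul_one, mul_inv_rev, s_inv]

lemma length_mul_le (x y : D.W) : D.length (x * y) ≤ D.length x + D.length y := by
  obtain ⟨l, h1, h2⟩ := exists_reduced x
  obtain ⟨l', h1', h2'⟩ := exists_reduced y
  have := length_le (l := l ++ l') (g := x * y) (by rw [wordProd_append, h1, h1'])
  rw [List.length_append] at this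
  omega

/-- a factorization of a reduced word gives an inversion -/
lemma inversion (hsl : D.SimplyLaced) {q t : List D.I} {i : D.I} {u : D.W}
    (h : D.IsReduced (q ++ i :: t) u) :
    D.PP (D.act (D.wordProd t)⁻¹ (D.simple i)) ∧ D.PP (D.act (D.wordProd q) (D.simple i)) := by
  obtain ⟨h1, h2⟩ := h
  rw [wordProd_append, wordProd_cons] at h1
  simp only [List.length_append, List.length_cons] at h2
  have ht := length_le (rfl : D.wordProd t = D.wordProd t)
  have hq := length_le (rfl : D.wordProd q = D.wordProd q)
  constructor
  · rcases ((D.phi_simple i).act (D.wordProd t)⁻¹).pos_or with h | h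
    · exact h
    · exfalso
      have h3 := len_lt_left hsl (D.pp_simple i) h
      have h4 := length_mul_le (D.wordProd q) (D.s i * D.wordProd t)
      rw [h1] at h4
      change D.length (D.s i * D.wordProd t) < _ at h3
      omega
  · rcases ((D.phi_simple i).act (D.wordProd q)).pos_or with h | h
    · exact h
    · exfalso
      have h3 := len_lt hsl (D.pp_simple i) h
      have h4 := length_mul_le (D.wordProd q * D.s i) (D.wordProd t)
      rw [mul_assoc, h1] at h4
      change D.length (D.wordProd q * D.s i) < _ at h3
      omega

lemma chn_transfer (hsl : D.SimplyLaced) {m : D.V} {l l' : List D.I} {u : D.W}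
    (hl : D.Chn m l) (hu : D.wordProd l = u) (hred : D.IsReduced l' u) : D.Chn m l' := by
  have key : ∀ t q, q ++ t = l' → D.Chn m t := by
    intro t
    induction t with
    | nil => intro _ _; trivial
    | cons i t ih =>
      intro q hq
      refine ⟨?_, ih (q ++ [i]) (by rw [← hq]; simp)⟩
      rw [← hq] at hred
      obtain ⟨h1, h2⟩ := inversion hsl hred
      have h3 := hred.1
      rw [wordProd_append, wordProd_cons] at h3
      have h4 := chn_inv hsl l hl h1 (by
        rw [hu, ← h3, act_mul, act_mul, act_act_inv, s_simple, map_neg, neg_neg]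
        exact h2)
      rwa [← D.coroot_act _ (D.simple_mem i)] at h4
  exact key l' [] rfl

lemma chn_diff {m p : D.V} (l : List D.I) (h1 : D.Chn m l) (h2 : D.Chn p l) :
    D.act (D.wordProd l) m - m = D.act (D.wordProd l) p - p := by
  induction l with
  | nil => simp [wordProd_nil]
  | cons i t ih =>
    have := ih h1.2 h2.2
    rw [wordProd_cons, act_mul, act_mul, s_of_pos i h1.1, s_of_pos i h2.1, sub_right_comm, this]
    abel

lemma chn_pair {m p : D.V} (l : List D.I) (h1 : D.Chn m l) (h2 : D.Chn p l) :
    ∀ i ∈ l, D.coroot (D.simple i) m = D.coroot (D.simple i) p := by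
  induction l with
  | nil => simp
  | cons j t ih =>
    intro i hi
    rcases List.mem_cons.mp hi with rfl | hi
    · have h3 := congrArg (D.coroot (D.simple i)) (chn_diff t h1.2 h2.2)
      rw [map_sub, map_sub, h1.1, h2.1] at h3
      linarith
    · exact ih h1.2 h2.2 i hi

end WeylSetting

/-- **Skew Nakada formula (simply-laced case).** For a simply-laced Weyl group,
`π`-minuscule `v ≤ w` with `w v⁻¹` `π'`-minuscule for some dominant integral
`π'`, the sum over all directed paths `v ≤ x_r →β_r ⋯ →β₁ x_0 = w` in `W^P` of
`1/β₁ ⋯ 1/(β₁+⋯+β_r)` equals `∏_{β ∈ S(w/v)} (1 + 1/β)`. -/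
theorem skew_nakada_simply_laced
    (D : WeylSetting) (hsl : D.SimplyLaced)
    (pi : D.V) (hpi : D.IsDominant pi)
    (v w : D.W) (hv : D.IsMinuscule pi v) (hw : D.IsMinuscule pi w)
    (hvr : D.IsMinRep (D.stab pi) v) (hwr : D.IsMinRep (D.stab pi) w)
    (hvw : D.bruhatLE v w)
    (hmin : ∃ pi' : D.V, D.IsDominant pi' ∧ D.IsMinuscule pi' (w * v⁻¹))
    (F : Type) [Field F] [Algebra ℚ F] (emb : D.V →ₗ[ℚ] F)
    (hemb : Function.Injective emb) :
    (∑ᶠ l : List D.V,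
        if D.ArrowPathGE (D.stab pi) v w l then D.pathTerm emb l else 0) =
      ∏ β ∈ D.SsetSkew v w, (1 + (emb β)⁻¹) := by
  obtain ⟨pi', hpi', l', hred, hmin'⟩ := hmin
  have hpre := WeylSetting.pre_of_minuscule hsl hpi hw
  have hV := WeylSetting.mr_of_minRep hsl hvr
  have hW := WeylSetting.mr_of_minRep hsl hwr
  have hr := WeylSetting.bruhat_reach hsl hpi hvw hpre
  obtain ⟨-, l, hl, hwl⟩ := WeylSetting.reach_word hsl hpi hW hV hpre hr
  have hu : D.wordProd l = w * v⁻¹ := by rw [hwl]; group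
  have hl' := WeylSetting.chn_transfer hsl hl hu hred
  have hnn : ∀ i ∈ l', 0 ≤ D.coroot (D.simple i) (D.act v pi) := by
    intro i hi
    rw [WeylSetting.chn_pair l' hl' (WeylSetting.chn_of_minuscule l' hmin') i hi]
    exact hpi'.2 i
  have hf := WeylSetting.wpath_finite hsl hpi hW hpre
  have e : D.act (D.wordProd l') (D.act v pi) = D.act w pi := by
    rw [hred.1, ← WeylSetting.act_mul]
    congr 2
    group
  have key := WeylSetting.weight_formula hsl l' hl' hnn emb hemb (by rw [e]; exact hpre)
    (by rw [e]; exact hf)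
  rw [e] at key
  rw [WeylSetting.sset_eq hsl hpi hV hW hpre, ← key]
  unfold WeylSetting.GG
  rw [finsum_eq_sum_of_support_subset (s := (D.PF (D.act w pi)).filter
    (fun l => D.Reach (D.act w pi + l.sum) (D.act v pi)))]
  · refine Finset.sum_congr rfl fun t ht => ?_
    rw [Finset.mem_filter, WeylSetting.mem_PF hf] at ht
    rw [if_pos ((WeylSetting.arrowPath_iff hsl hpi hV t hW hpre hr).mpr ht)]
  · intro t ht
    rw [Function.mem_support] at ht
    have h : D.ArrowPathGE (D.stab pi) v w t := by
      by_contra hc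
      exact ht (if_neg hc)
    rw [Finset.mem_coe, Finset.mem_filter, WeylSetting.mem_PF hf]
    exact (WeylSetting.arrowPath_iff hsl hpi hV t hW hpre hr).mp h
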